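/- Let k be an algebraically closed field of characteristic 2 and let G = SL(n+1, k), n ≥ 1. A non-trivial unipotent conjugacy class O of G is spherical if and only if O = X_i, the class with Jordan type 2^i ⊕ 1^{n+1−2i}, for some i with 1 ≤ i ≤ ⌊(n+1)/2⌋; equivalently, if and only if O consists of involutions. Moreover, each X_i satisfies condition (*): for w = s_{β₁}⋯s_{β_i} with β_j = e_j − e_{n+2−j} (pairwise orthogonal positive roots), the element n_{β₁}⋯n_{β_i} lies in X_i ∩ BwB and dim X_i = ℓ(w) + rk(1−w). -/

import Mathlib

open scoped Matrix

section SphericalDefs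

variable (G : Type*) [Group G] [TopologicalSpace G]

/-- A Borel subgroup of an algebraic group: a maximal closed connected solvable subgroup. -/
def IsBorel (B : Subgroup G) : Prop :=
  IsClosed (B : Set G) ∧ IsConnected (B : Set G) ∧ IsSolvable B ∧
    ∀ B' : Subgroup G, IsClosed (B' : Set G) → IsConnected (B' : Set G) → IsSolvable B' →
      B ≤ B' → B' = B

variable {G}

/-- The orbit of `x` under conjugation by elements of a subgroup `B`. -/
def conjOrbit (B : Subgroup G) (x : G) : Set G := {g | ∃ b ∈ B, g = b * x * b⁻¹}

/-- The conjugacy class of `u`. -/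
def conjClass (u : G) : Set G := {v | IsConj u v}

variable (G)

/-- A subset (typically a conjugacy class) of `G` is *spherical* if a Borel subgroup of `G`
has a dense orbit on it (acting by conjugation). -/
def IsSphericalClass (O : Set G) : Prop :=
  ∃ B : Subgroup G, IsBorel G B ∧ ∃ x ∈ O, O ⊆ closure (conjOrbit B x)

/-- A subgroup `H ≤ G` is a *spherical subgroup* if a Borel subgroup of `G` has a dense
orbit on the homogeneous space `G ⧸ H`, i.e. `G ⧸ H` is a spherical homogeneous space. -/
def IsSphericalSubgroup (H : Subgroup G) : Prop :=
  ∃ B : Subgroup G, IsBorel G B ∧ ∃ x : G ⧸ H, Dense {y : G ⧸ H | ∃ b ∈ B, y = b • x}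

end SphericalDefs

/-- The (classical) Zariski topology on the affine space `ι → k`:
a basis of open sets is given by the nonvanishing loci of polynomials. -/
def zariskiTopology (k : Type*) [CommRing k] (ι : Type*) : TopologicalSpace (ι → k) :=
  TopologicalSpace.generateFrom
    {s | ∃ p : MvPolynomial ι k, s = {v | MvPolynomial.eval v p ≠ 0}}

/-- The Zariski topology on the space of square matrices. -/
instance matrixZariskiTopology (m k : Type*) [CommRing k] :
    TopologicalSpace (Matrix m m k) :=
  TopologicalSpace.induced (fun M (p : m × m) => M p.1 p.2) (zariskiTopology k (m × m))

/-- The Zariski topology on `SL(N, k)`, as a Zariski closed subvariety of the matrix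
space. -/
instance slZariskiTopology (N : ℕ) (k : Type*) [CommRing k] :
    TopologicalSpace (Matrix.SpecialLinearGroup (Fin N) k) :=
  TopologicalSpace.induced (fun g => (g : Matrix (Fin N) (Fin N) k)) inferInstance

noncomputable section

open scoped Classical

variable (k : Type*) [Field k] (n : ℕ)

/-- The Borel subgroup `B` of upper triangular matrices in `SL(N, k)`.  (The inverse of an
invertible upper triangular matrix is upper triangular, so the second condition in the
carrier is redundant; it is included to make the subgroup axioms evident.) -/
def slBorel (N : ℕ) : Subgroup (Matrix.SpecialLinearGroup (Fin N) k) where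
  carrier := {g | ((g : Matrix (Fin N) (Fin N) k)).BlockTriangular id ∧
      ((g⁻¹ : Matrix.SpecialLinearGroup (Fin N) k) : Matrix (Fin N) (Fin N) k).BlockTriangular id}
  one_mem' := by
    constructor <;> simp [Matrix.blockTriangular_one]
  mul_mem' := by
    rintro a b ⟨ha, ha'⟩ ⟨hb, hb'⟩
    refine ⟨?_, ?_⟩
    · rw [Matrix.SpecialLinearGroup.coe_mul]; exact ha.mul hb
    · rw [mul_inv_rev, Matrix.SpecialLinearGroup.coe_mul]; exact hb'.mul ha'
  inv_mem' := by
    rintro a ⟨ha, ha'⟩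
    refine ⟨ha', ?_⟩
    rw [inv_inv]; exact ha

/-- `aIdx n j` is the (0-indexed) index of the basis vector `e_{j+1}`. -/
def aIdx (j : ℕ) : Fin (n + 1) := ⟨j % (n + 1), Nat.mod_lt _ n.succ_pos⟩

/-- `bIdx n j` is the (0-indexed) index of the basis vector `e_{n+1-j}`. -/
def bIdx (j : ℕ) : Fin (n + 1) := ⟨(n - j) % (n + 1), Nat.mod_lt _ n.succ_pos⟩

/-- For the root `β_j = e_j - e_{n+2-j}` (`1 ≤ j ≤ (n+1)/2`, here `j = j'+1` with
`j' = 0, 1, …`), the representative `n_{β_j} = x_{β_j}(1) x_{-β_j}(-1) x_{β_j}(1)` of the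
reflection `s_{β_j}`, as a matrix. -/
def nMat (j : ℕ) : Matrix (Fin (n + 1)) (Fin (n + 1)) k :=
  Matrix.transvection (aIdx n j) (bIdx n j) 1 *
    Matrix.transvection (bIdx n j) (aIdx n j) (-1) *
    Matrix.transvection (aIdx n j) (bIdx n j) 1

/-- The element `n_{β₁} ⋯ n_{β_i}`, as a matrix. -/
def nMatProd (i : ℕ) : Matrix (Fin (n + 1)) (Fin (n + 1)) k :=
  (List.ofFn fun j : Fin i => nMat k n j).prod

/-- The element `w = s_{β₁} ⋯ s_{β_i}` of the Weyl group `W = S_{n+1}`, a product of `i`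
pairwise disjoint (hence commuting) transpositions. -/
def wPerm (i : ℕ) : Equiv.Perm (Fin (n + 1)) :=
  (List.ofFn fun j : Fin i => Equiv.swap (aIdx n j) (bIdx n j)).prod

/-- The permutation matrix of `σ`, over a commutative ring `R`. -/
def permMat (R : Type*) [CommRing R] {N : ℕ} (σ : Equiv.Perm (Fin N)) :
    Matrix (Fin N) (Fin N) R :=
  Matrix.of fun a b => if σ b = a then (1 : R) else 0

/-- The length `ℓ(w)` of a permutation: its number of inversions. -/
def lenPerm {N : ℕ} (σ : Equiv.Perm (Fin N)) : ℕ :=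
  Nat.card {p : Fin N × Fin N // p.1 < p.2 ∧ σ p.2 < σ p.1}

/-- The rank of `1 - w` in the geometric representation of the Weyl group `W = S_{n+1}`
(equivalently, on the permutation representation, since `w` fixes the vector
`(1, …, 1)`). -/
def rkOneSubPerm {N : ℕ} (σ : Equiv.Perm (Fin N)) : ℕ :=
  ((1 : Matrix (Fin N) (Fin N) ℝ) - permMat ℝ σ).rank

/-- The unipotent conjugacy class `X_i` of `SL(n+1, k)` with Jordan type
`2^i ⊕ 1^{n+1-2i}`: `i` Jordan blocks of size 2 and `n+1-2i` of size 1. -/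
def slX (i : ℕ) : Set (Matrix.SpecialLinearGroup (Fin (n + 1)) k) :=
  {g | ((g : Matrix (Fin (n + 1)) (Fin (n + 1)) k) - 1) ^ 2 = 0 ∧
    ((g : Matrix (Fin (n + 1)) (Fin (n + 1)) k) - 1).rank = i}

/-- The Bruhat double coset `B w B` in `SL(n+1, k)`, for `w ∈ W = S_{n+1}`. -/
def slBruhatCell (σ : Equiv.Perm (Fin (n + 1))) :
    Set (Matrix.SpecialLinearGroup (Fin (n + 1)) k) :=
  {g | ∃ b₁ ∈ slBorel k (n + 1), ∃ b₂ ∈ slBorel k (n + 1),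
    (g : Matrix (Fin (n + 1)) (Fin (n + 1)) k) =
      (b₁ : Matrix (Fin (n + 1)) (Fin (n + 1)) k) * permMat k σ *
        (b₂ : Matrix (Fin (n + 1)) (Fin (n + 1)) k)}

section ZariskiBasics

attribute [local instance] zariskiTopology

open MvPolynomial

variable {K : Type*} [Field K] {ι : Type*}

theorem isOpen_zariski_ne_zero (p : MvPolynomial ι K) :
    IsOpen {v : ι → K | eval v p ≠ 0} :=
  TopologicalSpace.isOpen_generateFrom_of_mem ⟨p, rfl⟩

/-- The nonvanishing loci of polynomials form a basis of the Zariski topology. -/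
theorem exists_eval_ne_zero_of_isOpen {U : Set (ι → K)} (hU : IsOpen U) {x : ι → K}
    (hx : x ∈ U) :
    ∃ p : MvPolynomial ι K, eval x p ≠ 0 ∧ ∀ v, eval v p ≠ 0 → v ∈ U := by
  induction hU with
  | basic s hs =>
    obtain ⟨p, rfl⟩ := hs
    exact ⟨p, hx, fun v hv => hv⟩
  | univ => exact ⟨1, by simp, by simp⟩
  | inter s t _ _ hs ht =>
    obtain ⟨p, hp, hp'⟩ := hs hx.1
    obtain ⟨q, hq, hq'⟩ := ht hx.2
    refine ⟨p * q, by simp [hp, hq], fun v hv => ?_⟩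
    rw [map_mul] at hv
    exact ⟨hp' v (left_ne_zero_of_mul hv), hq' v (right_ne_zero_of_mul hv)⟩
  | sUnion S _ h =>
    obtain ⟨t, ht, hxt⟩ := hx
    obtain ⟨p, hp, hp'⟩ := h t ht hxt
    exact ⟨p, hp, fun v hv => ⟨t, ht, hp' v hv⟩⟩

theorem isClosed_zeroLocus (I : Ideal (MvPolynomial ι K)) : IsClosed (zeroLocus K I) := by
  have : zeroLocus K I = ⋂ p ∈ I, {v : ι → K | eval v p ≠ 0}ᶜ := by
    ext v
    simp [mem_zeroLocus_iff, aeval_eq_eval]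
  rw [this]
  exact isClosed_biInter fun p _ => (isOpen_zariski_ne_zero p).isClosed_compl

theorem zeroLocus_vanishingIdeal_of_isClosed {Z : Set (ι → K)} (hZ : IsClosed Z) :
    zeroLocus K (vanishingIdeal K Z) = Z := by
  refine Set.Subset.antisymm (fun x hx => ?_) (zeroLocus_vanishingIdeal_le Z)
  by_contra hxZ
  obtain ⟨p, hp, hp'⟩ := exists_eval_ne_zero_of_isOpen hZ.isOpen_compl hxZ
  refine hp ?_
  have := hx p (by
    rw [mem_vanishingIdeal_iff]
    intro y hy
    by_contra hne
    exact hp' y (by simpa [aeval_eq_eval] using hne) hy)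
  simpa [aeval_eq_eval] using this

theorem isPrime_vanishingIdeal {Z : Set (ι → K)} (hZ : IsIrreducible Z) :
    (vanishingIdeal K Z).IsPrime := by
  constructor
  · rw [Ideal.ne_top_iff_one]
    intro h
    obtain ⟨x, hx⟩ := hZ.1
    simpa using h x hx
  · intro p q hpq
    by_contra! h
    simp only [mem_vanishingIdeal_iff, aeval_eq_eval, not_forall] at h
    obtain ⟨⟨x, hx, hpx⟩, y, hy, hqy⟩ := h
    obtain ⟨z, hz, h1, h2⟩ := hZ.2 _ _ (isOpen_zariski_ne_zero p) (isOpen_zariski_ne_zero q)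
      ⟨x, hx, hpx⟩ ⟨y, hy, hqy⟩
    have := hpq z hz
    rw [aeval_eq_eval] at this
    rw [map_mul] at this
    exact (mul_ne_zero h1 h2) this

theorem isIrreducible_zeroLocus [IsAlgClosed K] [Finite ι] (P : Ideal (MvPolynomial ι K))
    [hP : P.IsPrime] : IsIrreducible (zeroLocus K P) := by
  have hv : vanishingIdeal K (zeroLocus K P) = P := IsPrime.vanishingIdeal_zeroLocus P
  constructor
  · by_contra h
    rw [Set.not_nonempty_iff_eq_empty] at h
    rw [h, vanishingIdeal_empty] at hv
    exact hP.ne_top hv.symm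
  · rintro U V hU hV ⟨x, hxP, hxU⟩ ⟨y, hyP, hyV⟩
    obtain ⟨p, hp, hp'⟩ := exists_eval_ne_zero_of_isOpen hU hxU
    obtain ⟨q, hq, hq'⟩ := exists_eval_ne_zero_of_isOpen hV hyV
    by_contra hne
    have hpq : p * q ∈ P := by
      rw [← hv, mem_vanishingIdeal_iff]
      intro z hz
      by_contra hz'
      simp only [aeval_eq_eval, map_mul, mul_eq_zero, not_or] at hz'
      exact hne ⟨z, hz, hp' z hz'.1, hq' z hz'.2⟩
    rcases hP.mem_or_mem hpq with h | h
    · exact hp (by simpa [aeval_eq_eval] using hxP p h)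
    · exact hq (by simpa [aeval_eq_eval] using hyP q h)

/-- The Krull dimension of affine space in its Zariski topology. -/
theorem topologicalKrullDim_affineSpace [IsAlgClosed K] [Finite ι] :
    topologicalKrullDim (ι → K) = Nat.card ι := by
  have hdim : ringKrullDim (MvPolynomial ι K) = Nat.card ι := by
    rw [MvPolynomial.ringKrullDim_of_isNoetherianRing, ringKrullDim_eq_zero_of_field, zero_add]
  rw [← hdim]
  apply le_antisymm
  · rw [topologicalKrullDim, ringKrullDim, ← Order.krullDim_orderDual]
    refine Order.krullDim_le_of_strictMono
      (fun Z : (TopologicalSpace.IrreducibleCloseds (ι → K))ᵒᵈ =>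
        (⟨vanishingIdeal K ((OrderDual.ofDual Z).carrier),
          isPrime_vanishingIdeal (OrderDual.ofDual Z).isIrreducible⟩ :
            PrimeSpectrum (MvPolynomial ι K))) ?_
    apply Monotone.strictMono_of_injective
    · intro Z W h
      exact vanishingIdeal_anti_mono (k := K) h
    · intro Z W h
      have h' := congrArg (fun P => zeroLocus K P.asIdeal) h
      dsimp only at h'
      rw [zeroLocus_vanishingIdeal_of_isClosed (OrderDual.ofDual Z).isClosed',
        zeroLocus_vanishingIdeal_of_isClosed (OrderDual.ofDual W).isClosed'] at h'
      exact TopologicalSpace.IrreducibleCloseds.ext h'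
  · rw [topologicalKrullDim, ringKrullDim, ← Order.krullDim_orderDual]
    refine Order.krullDim_le_of_strictMono
      (fun P => (⟨zeroLocus K (OrderDual.ofDual P).asIdeal,
        isIrreducible_zeroLocus (OrderDual.ofDual P).asIdeal, isClosed_zeroLocus _⟩ :
          TopologicalSpace.IrreducibleCloseds (ι → K))) ?_
    apply Monotone.strictMono_of_injective
    · intro P Q h
      exact zeroLocus_anti_mono (K := K) h
    · intro P Q h
      have h' := congrArg (fun Z : TopologicalSpace.IrreducibleCloseds (ι → K) =>
        vanishingIdeal K (Z : Set (ι → K))) h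
      simp only [TopologicalSpace.IrreducibleCloseds.coe_mk,
        IsPrime.vanishingIdeal_zeroLocus] at h'
      exact PrimeSpectrum.ext h'

theorem isIrreducible_zariski_ne_zero [Infinite K] {p : MvPolynomial ι K} (hp : p ≠ 0) :
    IsIrreducible {v : ι → K | eval v p ≠ 0} := by
  have key : ∀ q : MvPolynomial ι K, q ≠ 0 → ∃ v, eval v q ≠ 0 := by
    intro q hq
    by_contra! h
    exact hq (MvPolynomial.funext fun v => by simpa using h v)
  refine ⟨key p hp, ?_⟩
  rintro U V hU hV ⟨x, -, hxU⟩ ⟨y, -, hyV⟩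
  obtain ⟨q, hq, hq'⟩ := exists_eval_ne_zero_of_isOpen hU hxU
  obtain ⟨r, hr, hr'⟩ := exists_eval_ne_zero_of_isOpen hV hyV
  obtain ⟨v, hv⟩ := key (p * q * r) (mul_ne_zero (mul_ne_zero hp (by rintro rfl; simp at hq))
    (by rintro rfl; simp at hr))
  simp only [map_mul, mul_ne_zero_iff] at hv
  exact ⟨v, hv.1.1, hq' v hv.1.2, hr' v hv.2⟩

/-- If a space is covered by the translates of an open subset under self-homeomorphisms, then
its Krull dimension is that of the open subset. -/
theorem topologicalKrullDim_eq_of_isOpen {X : Type*} [TopologicalSpace X] {U : Set X}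
    (hU : IsOpen U) (h : ∀ x, ∃ φ : X ≃ₜ X, φ x ∈ U) :
    topologicalKrullDim X = topologicalKrullDim U := by
  refine le_antisymm ?_ (topologicalKrullDim_subspace_le X U)
  rcases isEmpty_or_nonempty X with hX | hX
  · have : IsEmpty (TopologicalSpace.IrreducibleCloseds X) :=
      ⟨fun Z => hX.elim Z.isIrreducible.nonempty.some⟩
    rw [topologicalKrullDim, Order.krullDim_eq_bot_iff.2 this]
    exact bot_le
  have : Nonempty (TopologicalSpace.IrreducibleCloseds X) :=
    ⟨⟨closure {hX.some}, isIrreducible_singleton.closure, isClosed_closure⟩⟩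
  rw [topologicalKrullDim, Order.krullDim_eq_iSup_coheight]
  refine iSup_le fun Z => ?_
  obtain ⟨x, hx⟩ := Z.isIrreducible.nonempty
  obtain ⟨φ, hφ⟩ := h x
  let f : U → X := fun y => φ.symm y
  have hf : Topology.IsOpenEmbedding f :=
    φ.symm.isOpenEmbedding.comp hU.isOpenEmbedding_subtypeVal
  have hirr : IsIrreducible (f ⁻¹' (Z : Set X)) :=
    ⟨⟨⟨φ x, hφ⟩, by simpa [f] using hx⟩, Z.isIrreducible.isPreirreducible.preimage hf⟩
  let W : TopologicalSpace.IrreducibleCloseds U :=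
    ⟨f ⁻¹' Z, hirr, Z.isClosed.preimage hf.continuous⟩
  have hWZ : W.map f hf.continuous = Z := by
    apply TopologicalSpace.IrreducibleCloseds.ext
    rw [TopologicalSpace.IrreducibleCloseds.coe_map]
    apply Set.Subset.antisymm
    · exact closure_minimal (Set.image_preimage_subset _ _) Z.isClosed
    · have h1 : (Z : Set X) ⊆ closure ((Z : Set X) ∩ Set.range f) :=
        subset_closure_inter_of_isPreirreducible_of_isOpen Z.isIrreducible.isPreirreducible
          hf.isOpen_range ⟨x, hx, ⟨φ x, hφ⟩, by simp [f]⟩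
      rwa [← Set.image_preimage_eq_inter_range] at h1
  rw [← hWZ, hf.coheight_map]
  exact Order.coheight_le_krullDim W

/-- A nonempty open subset of affine space has full dimension. -/
theorem topologicalKrullDim_isOpen_affineSpace [IsAlgClosed K] [Finite ι] {U : Set (ι → K)}
    (hU : IsOpen U) (hne : U.Nonempty) : topologicalKrullDim U = Nat.card ι := by
  rw [← topologicalKrullDim_affineSpace (K := K) (ι := ι)]
  symm
  obtain ⟨u, hu⟩ := hne
  have hcont : ∀ w : ι → K, Continuous (fun v : ι → K => v + w) := by
    intro w
    refine continuous_generateFrom_iff.2 ?_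
    rintro _ ⟨p, rfl⟩
    have : (fun v : ι → K => v + w) ⁻¹' {v | eval v p ≠ 0} =
        {v | eval v (bind₁ (fun i => X i + C (w i)) p) ≠ 0} := by
      ext v
      simp only [Set.mem_preimage, Set.mem_ofPred_eq, eval, eval₂Hom_bind₁]
      simp [Pi.add_def]
    rw [this]
    exact isOpen_zariski_ne_zero _
  refine topologicalKrullDim_eq_of_isOpen hU fun x => ⟨⟨Equiv.addRight (u - x), ?_, ?_⟩, ?_⟩
  · exact hcont _
  · simpa [Equiv.addRight] using hcont (-(u - x))
  · change x + (u - x) ∈ U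
    simpa using hu

end ZariskiBasics

section RegularFunctions

attribute [local instance] zariskiTopology

open MvPolynomial

variable {K : Type*} [Field K] {ι κ X : Type*}

/-- The functions on `X` that are quotients of polynomials in the coordinates
`e : X → ι → K`, with nowhere vanishing denominator. -/
def regularFunctions (e : X → ι → K) : Subalgebra K (X → K) where
  carrier := {f | ∃ p q : MvPolynomial ι K,
    ∀ x, eval (e x) q ≠ 0 ∧ f x * eval (e x) q = eval (e x) p}
  mul_mem' := by
    rintro f g ⟨p, q, h⟩ ⟨p', q', h'⟩
    refine ⟨p * p', q * q', fun x => ⟨by simpa using ⟨(h x).1, (h' x).1⟩, ?_⟩⟩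
    rw [map_mul, map_mul, ← (h x).2, ← (h' x).2, Pi.mul_apply]
    ring
  add_mem' := by
    rintro f g ⟨p, q, h⟩ ⟨p', q', h'⟩
    refine ⟨p * q' + p' * q, q * q', fun x => ⟨by simpa using ⟨(h x).1, (h' x).1⟩, ?_⟩⟩
    rw [map_mul, map_add, map_mul, map_mul, ← (h x).2, ← (h' x).2, Pi.add_apply]
    ring
  algebraMap_mem' := fun c => ⟨C c, 1, fun x => by simp⟩

theorem coord_mem_regularFunctions (e : X → ι → K) (i : ι) :
    (fun x => e x i) ∈ regularFunctions e :=
  ⟨MvPolynomial.X i, 1, fun x => by simp⟩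

theorem const_mem_regularFunctions (e : X → ι → K) (c : K) :
    (fun _ => c) ∈ regularFunctions e :=
  (regularFunctions e).algebraMap_mem c

theorem inv_mem_regularFunctions {e : X → ι → K} {f : X → K} (hf : f ∈ regularFunctions e)
    (h0 : ∀ x, f x ≠ 0) : (fun x => (f x)⁻¹) ∈ regularFunctions e := by
  obtain ⟨p, q, h⟩ := hf
  refine ⟨q, p, fun x => ⟨?_, ?_⟩⟩
  · rw [← (h x).2]
    exact mul_ne_zero (h0 x) (h x).1
  · rw [← (h x).2, inv_mul_cancel_left₀ (h0 x)]

theorem sum_mem_regularFunctions {e : X → ι → K} {α : Type*} (s : Finset α) {f : α → X → K}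
    (h : ∀ a ∈ s, f a ∈ regularFunctions e) :
    (fun x => ∑ a ∈ s, f a x) ∈ regularFunctions e := by
  have := (regularFunctions e).sum_mem h
  convert this using 1
  ext x
  simp

theorem prod_mem_regularFunctions {e : X → ι → K} {α : Type*} (s : Finset α) {f : α → X → K}
    (h : ∀ a ∈ s, f a ∈ regularFunctions e) :
    (fun x => ∏ a ∈ s, f a x) ∈ regularFunctions e := by
  have := (regularFunctions e).prod_mem h
  convert this using 1
  ext x
  simp

theorem isOpen_ne_zero_of_regular [TopologicalSpace X] {e : X → ι → K} (he : Continuous e)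
    {f : X → K} (hf : f ∈ regularFunctions e) : IsOpen {x | f x ≠ 0} := by
  obtain ⟨p, q, h⟩ := hf
  have : {x | f x ≠ 0} = e ⁻¹' {v | eval v p ≠ 0} := by
    ext x
    simp only [Set.mem_preimage, Set.mem_ofPred_eq, ← (h x).2, mul_ne_zero_iff, (h x).1,
      ne_eq, not_false_eq_true, and_true]
  rw [this]
  exact (isOpen_zariski_ne_zero p).preimage he

theorem eval_mem_regularFunctions {e : X → ι → K} {φ : X → κ → K}
    (hφ : ∀ j, (fun x => φ x j) ∈ regularFunctions e) (p : MvPolynomial κ K) :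
    (fun x => eval (φ x) p) ∈ regularFunctions e := by
  induction p using MvPolynomial.induction_on with
  | C c => simpa using const_mem_regularFunctions e c
  | add p q hp hq => simpa using! (regularFunctions e).add_mem hp hq
  | mul_X p j hp => simpa using! (regularFunctions e).mul_mem hp (hφ j)

theorem continuous_of_regular [TopologicalSpace X] {e : X → ι → K} (he : Continuous e)
    {φ : X → κ → K} (hφ : ∀ j, (fun x => φ x j) ∈ regularFunctions e) : Continuous φ := by
  refine continuous_generateFrom_iff.2 ?_
  rintro _ ⟨p, rfl⟩
  exact isOpen_ne_zero_of_regular he (eval_mem_regularFunctions hφ p)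

section Matrices

variable {l m n : Type*}

/-- A family of matrices all of whose entries are regular functions. -/
def IsRegularMatrix (e : X → ι → K) (A : X → Matrix m n K) : Prop :=
  ∀ i j, (fun x => A x i j) ∈ regularFunctions e

namespace IsRegularMatrix

variable {e : X → ι → K}

theorem const (M : Matrix m n K) : IsRegularMatrix e fun _ => M :=
  fun i j => const_mem_regularFunctions e (M i j)

theorem add {A B : X → Matrix m n K} (hA : IsRegularMatrix e A) (hB : IsRegularMatrix e B) :
    IsRegularMatrix e fun x => A x + B x :=
  fun i j => (regularFunctions e).add_mem (hA i j) (hB i j)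

theorem neg {A : X → Matrix m n K} (hA : IsRegularMatrix e A) :
    IsRegularMatrix e fun x => - A x :=
  fun i j => (regularFunctions e).neg_mem (hA i j)

theorem sub {A B : X → Matrix m n K} (hA : IsRegularMatrix e A) (hB : IsRegularMatrix e B) :
    IsRegularMatrix e fun x => A x - B x :=
  fun i j => (regularFunctions e).sub_mem (hA i j) (hB i j)

theorem mul [Fintype m] {A : X → Matrix l m K} {B : X → Matrix m n K}
    (hA : IsRegularMatrix e A) (hB : IsRegularMatrix e B) :
    IsRegularMatrix e fun x => A x * B x :=
  fun i j => sum_mem_regularFunctions _ fun a _ =>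
    (regularFunctions e).mul_mem (hA i a) (hB a j)

theorem smul {f : X → K} {A : X → Matrix m n K} (hf : f ∈ regularFunctions e)
    (hA : IsRegularMatrix e A) : IsRegularMatrix e fun x => f x • A x :=
  fun i j => (regularFunctions e).mul_mem hf (hA i j)

theorem submatrix {l' : Type*} {A : X → Matrix m n K} (hA : IsRegularMatrix e A) (r : l → m)
    (c : l' → n) :
    IsRegularMatrix e fun x => (A x).submatrix r c :=
  fun i j => hA (r i) (c j)

theorem det [Fintype n] [DecidableEq n] {A : X → Matrix n n K} (hA : IsRegularMatrix e A) :
    (fun x => (A x).det) ∈ regularFunctions e := by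
  simp only [Matrix.det_apply']
  exact sum_mem_regularFunctions _ fun σ _ => (regularFunctions e).mul_mem
    (const_mem_regularFunctions e _) (prod_mem_regularFunctions _ fun i _ => hA _ _)

theorem adjugate [Fintype n] [DecidableEq n] {A : X → Matrix n n K}
    (hA : IsRegularMatrix e A) : IsRegularMatrix e fun x => (A x).adjugate := by
  intro i j
  simp only [Matrix.adjugate_apply]
  refine det fun a b => ?_
  simp only [Matrix.updateRow_apply]
  split_ifs
  · exact const_mem_regularFunctions e _
  · exact hA a b

theorem inv [Fintype n] [DecidableEq n] {A : X → Matrix n n K}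
    (hA : IsRegularMatrix e A) (h0 : ∀ x, (A x).det ≠ 0) :
    IsRegularMatrix e fun x => (A x)⁻¹ := by
  simp only [Matrix.inv_def, Ring.inverse_eq_inv']
  exact (hA.adjugate).smul (inv_mem_regularFunctions hA.det h0)

end IsRegularMatrix

/-- The matrix entries, as coordinates on `SL(N, K)`. -/
def slCoords {N : ℕ} (g : Matrix.SpecialLinearGroup (Fin N) K) (p : Fin N × Fin N) : K :=
  (g : Matrix (Fin N) (Fin N) K) p.1 p.2

theorem continuous_slCoords {N : ℕ} : Continuous (slCoords (K := K) (N := N)) := by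
  have h₁ : Continuous fun g : Matrix.SpecialLinearGroup (Fin N) K =>
    (g : Matrix (Fin N) (Fin N) K) := continuous_induced_dom
  have h₂ : Continuous fun (M : Matrix (Fin N) (Fin N) K) (p : Fin N × Fin N) => M p.1 p.2 :=
    continuous_induced_dom
  exact h₂.comp h₁

theorem isRegularMatrix_coe_sl {N : ℕ} {Y : Type*}
    (φ : Y → Matrix.SpecialLinearGroup (Fin N) K) :
    IsRegularMatrix (fun y => slCoords (φ y))
      fun y => (φ y : Matrix (Fin N) (Fin N) K) :=
  fun i j => coord_mem_regularFunctions (fun y => slCoords (φ y)) (i, j)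

theorem continuous_sl_of_regular {N : ℕ} [TopologicalSpace X] {e : X → ι → K}
    (he : Continuous e) {φ : X → Matrix.SpecialLinearGroup (Fin N) K}
    (hφ : IsRegularMatrix e fun x => (φ x : Matrix (Fin N) (Fin N) K)) : Continuous φ := by
  refine continuous_induced_rng.2 (continuous_induced_rng.2 ?_)
  exact continuous_of_regular he fun p => hφ p.1 p.2

theorem isRegularMatrix_conj {N : ℕ} (h h' : Matrix (Fin N) (Fin N) K) :
    IsRegularMatrix (slCoords (K := K) (N := N)) fun g => h * (g : Matrix _ _ K) * h' :=
  ((IsRegularMatrix.const h).mul (isRegularMatrix_coe_sl id)).mul (IsRegularMatrix.const h')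

theorem continuous_sl_conj {N : ℕ} (h : Matrix.SpecialLinearGroup (Fin N) K) :
    Continuous fun g : Matrix.SpecialLinearGroup (Fin N) K => h * g * h⁻¹ :=
  continuous_sl_of_regular continuous_slCoords <| by
    simp only [Matrix.SpecialLinearGroup.coe_mul]
    exact isRegularMatrix_conj _ _

/-- Conjugation by an element of `SL(N, K)` is a homeomorphism. -/
def slConjHomeomorph {N : ℕ} (h : Matrix.SpecialLinearGroup (Fin N) K) :
    Matrix.SpecialLinearGroup (Fin N) K ≃ₜ Matrix.SpecialLinearGroup (Fin N) K where
  toFun g := h * g * h⁻¹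
  invFun g := h⁻¹ * g * h⁻¹⁻¹
  left_inv g := by group
  right_inv g := by group
  continuous_toFun := continuous_sl_conj h
  continuous_invFun := continuous_sl_conj h⁻¹

end Matrices

end RegularFunctions

section LieKolchin

open scoped commutatorElement

variable {K : Type*} [Field K] {Γ : Type*} [Group Γ]

/-- A subgroup on which every function of the algebra `𝓐` taking only finitely many values is
constant. -/
def IsConnectedFor (𝓐 : Subalgebra K (Γ → K)) (D : Subgroup Γ) : Prop :=
  ∀ f ∈ 𝓐, (f '' D).Finite → ∀ x ∈ D, f x = f 1

theorem IsConnectedFor.commutator {𝓐 : Subalgebra K (Γ → K)}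
    (h𝓐 : ∀ f ∈ 𝓐, ∀ s y t, (fun x => f (s * (x * y * x⁻¹) * t)) ∈ 𝓐)
    {D : Subgroup Γ} (hD : IsConnectedFor 𝓐 D) : IsConnectedFor 𝓐 ⁅D, D⁆ := by
  intro f hf hfin
  let H : Subgroup Γ :=
    { carrier := {c | c ∈ ⁅D, D⁆ ∧ ∀ s ∈ ⁅D, D⁆, f (s * c) = f s}
      one_mem' := ⟨one_mem _, by simp⟩
      mul_mem' := by
        rintro a b ⟨ha, ha'⟩ ⟨hb, hb'⟩
        refine ⟨mul_mem ha hb, fun s hs => ?_⟩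
        rw [← mul_assoc, hb' _ (mul_mem hs ha), ha' s hs]
      inv_mem' := by
        rintro a ⟨ha, ha'⟩
        refine ⟨inv_mem ha, fun s hs => ?_⟩
        rw [← ha' _ (mul_mem hs (inv_mem ha)), inv_mul_cancel_right] }
  have hle : ⁅D, D⁆ ≤ H := by
    rw [Subgroup.commutator_le]
    intro x hx y hy
    refine ⟨Subgroup.commutator_mem_commutator hx hy, fun s hs => ?_⟩
    have h1 := hD _ (h𝓐 f hf s y y⁻¹) (hfin.subset ?_) x hx
    · simpa [commutatorElement_def, mul_assoc] using h1
    · rintro _ ⟨z, hz, rfl⟩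
      refine ⟨s * ⁅z, y⁆, mul_mem hs (Subgroup.commutator_mem_commutator hz hy), ?_⟩
      simp [commutatorElement_def, mul_assoc]
  intro x hx
  simpa using (hle hx).2 1 (one_mem _)

variable {V : Type*} [AddCommGroup V] [Module K V] [FiniteDimensional K V]

/-- Commuting operators on a nonzero invariant subspace have a common eigenvector in it. -/
theorem exists_common_eigenvector_of_commute [IsAlgClosed K] {α : Type*}
    (f : α → Module.End K V) (W : Submodule K V) (hW : W ≠ ⊥)
    (hinv : ∀ a, ∀ w ∈ W, f a w ∈ W) (hcomm : ∀ a b, ∀ w ∈ W, f a (f b w) = f b (f a w)) :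
    ∃ v ∈ W, v ≠ 0 ∧ ∀ a, ∃ c : K, f a v = c • v := by
  obtain ⟨U, ⟨hU0, hUW, hU⟩, hmin⟩ := (wellFounded_lt (α := Submodule K V)).has_min
    {U | U ≠ ⊥ ∧ U ≤ W ∧ ∀ a, ∀ w ∈ U, f a w ∈ U} ⟨W, hW, le_rfl, hinv⟩
  obtain ⟨v, hvU, hv0⟩ := Submodule.exists_mem_ne_zero_of_ne_bot hU0
  refine ⟨v, hUW hvU, hv0, fun a => ?_⟩
  have : Nontrivial U := ⟨⟨⟨v, hvU⟩, 0, fun h => hv0 (congrArg Subtype.val h)⟩⟩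
  obtain ⟨c, hc⟩ := Module.End.exists_eigenvalue ((f a).restrict (hU a))
  obtain ⟨w, hw⟩ := hc.exists_hasEigenvector
  have hw' : f a w = c • (w : V) := congrArg Subtype.val hw.apply_eq_smul
  by_contra hne
  refine hmin (U ⊓ Module.End.eigenspace (f a) c) ⟨?_, inf_le_left.trans hUW, ?_⟩
    (lt_of_le_of_ne inf_le_left fun h => hne ⟨c, ?_⟩)
  · intro hbot
    have : (w : V) ∈ U ⊓ Module.End.eigenspace (f a) c :=
      ⟨w.2, Module.End.mem_eigenspace_iff.2 hw'⟩
    rw [hbot, Submodule.mem_bot] at this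
    exact hw.2 (Subtype.ext this)
  · rintro b u ⟨hu, hu'⟩
    refine ⟨hU b u hu, Module.End.mem_eigenspace_iff.2 ?_⟩
    rw [hcomm a b u (hUW hu), Module.End.mem_eigenspace_iff.1 hu', map_smul]
  · rw [← h] at hvU
    exact Module.End.mem_eigenspace_iff.1 hvU.2

theorem exists_common_eigenvector_step [IsAlgClosed K] {𝓐 : Subalgebra K (Γ → K)}
    (h𝓐 : ∀ f ∈ 𝓐, ∀ s y t, (fun x => f (s * (x * y * x⁻¹) * t)) ∈ 𝓐)
    (ρ : Γ →* Module.End K V)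
    (hρ : ∀ (φ : Module.Dual K V) (v : V), (fun g => φ (ρ g v)) ∈ 𝓐)
    {D : Subgroup Γ} [D.Normal] (hD : IsConnectedFor 𝓐 D)
    (h : ∃ v : V, v ≠ 0 ∧ ∀ x ∈ ⁅D, D⁆, ∃ c : K, ρ x v = c • v) :
    ∃ v : V, v ≠ 0 ∧ ∀ x ∈ D, ∃ c : K, ρ x v = c • v := by
  obtain ⟨v, hv0, hv⟩ := h
  choose! χ hχ using hv
  obtain ⟨φ, hφ⟩ : ∃ φ : Module.Dual K V, φ v = 1 := by
    obtain ⟨φ, hφ⟩ : ∃ φ : Module.Dual K V, φ v ≠ 0 := by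
      by_contra! h
      exact hv0 ((Module.forall_dual_apply_eq_zero_iff K v).1 h)
    exact ⟨(φ v)⁻¹ • φ, by simp [hφ]⟩
  have hφχ : ∀ x ∈ ⁅D, D⁆, φ (ρ x v) = χ x := fun x hx => by simp [hχ x hx, hφ]
  have hnormal : ∀ g, ∀ x ∈ ⁅D, D⁆, g * x * g⁻¹ ∈ ⁅D, D⁆ := fun g x hx =>
    (Subgroup.commutator_normal D D).conj_mem x hx g
  have hconst : ∀ g ∈ D, ∀ x ∈ ⁅D, D⁆, χ (g * x * g⁻¹) = χ x := by
    intro g hg x hx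
    have h1 := hD (fun g => φ (ρ (1 * (g * x * g⁻¹) * 1) v)) (h𝓐 _ (hρ φ v) 1 x 1) ?_ g hg
    · simpa only [one_mul, mul_one, inv_one, hφχ _ (hnormal _ _ hx), hφχ x hx] using h1
    · refine (Module.End.finite_hasEigenvalue (ρ x)).subset ?_
      rintro _ ⟨g, hg, rfl⟩
      simp only [one_mul, mul_one, hφχ _ (hnormal g x hx)]
      refine Module.End.hasEigenvalue_of_hasEigenvector (x := ρ g⁻¹ v)
        ⟨Module.End.mem_eigenspace_iff.2 ?_, fun h0 => hv0 ?_⟩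
      · rw [← map_smul, ← hχ _ (hnormal g x hx), ← Module.End.mul_apply, ← Module.End.mul_apply,
          ← map_mul, ← map_mul]
        congr 2
        group
      · have := congrArg (ρ g) h0
        rwa [← Module.End.mul_apply, ← map_mul, mul_inv_cancel, map_one, map_zero] at this
  let W : Submodule K V := ⨅ x ∈ ⁅D, D⁆, Module.End.eigenspace (ρ x) (χ x)
  have hW : ∀ w, w ∈ W ↔ ∀ x ∈ ⁅D, D⁆, ρ x w = χ x • w := by
    simp [W, Submodule.mem_iInf]
  have hvW : v ∈ W := (hW v).2 hχ
  have hinv : ∀ g ∈ D, ∀ w ∈ W, ρ g w ∈ W := by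
    intro g hg w hw
    rw [hW] at hw ⊢
    intro x hx
    have hx' := hnormal g⁻¹ x hx
    rw [← hconst g⁻¹ (inv_mem hg) x hx, ← map_smul, ← hw _ hx', ← Module.End.mul_apply,
      ← Module.End.mul_apply, ← map_mul, ← map_mul]
    congr 2
    group
  have : Nontrivial W := ⟨⟨⟨v, hvW⟩, 0, fun h => hv0 (congrArg Subtype.val h)⟩⟩
  let r : D →* Module.End K W :=
    { toFun := fun g => (ρ g).restrict (hinv g g.2)
      map_one' := by
        ext w
        simp
      map_mul' := fun a b => by
        ext w
        simp }
  let ψ : D →* Kˣ := (LinearMap.det.comp r).toHomUnits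
  have hψ : ∀ x (hx : x ∈ D), x ∈ ⁅D, D⁆ → ψ ⟨x, hx⟩ = 1 := by
    have hle : ⁅D, D⁆ ≤ ψ.ker.map D.subtype := by
      rw [Subgroup.commutator_le]
      intro a ha b hb
      refine ⟨⁅(⟨a, ha⟩ : D), (⟨b, hb⟩ : D)⁆, ?_, rfl⟩
      simp only [SetLike.mem_coe, MonoidHom.mem_ker, map_commutatorElement]
      exact commutatorElement_eq_one_iff_commute.2 (Commute.all _ _)
    intro x hx hx'
    obtain ⟨y, hy, rfl⟩ := hle hx'
    exact hy
  have hpow : ∀ x ∈ ⁅D, D⁆, χ x ^ Module.finrank K W = 1 := by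
    intro x hx
    have hxD : x ∈ D := Subgroup.commutator_le_left D D hx
    have h1 : LinearMap.det (r ⟨x, hxD⟩) = 1 := congrArg Units.val (hψ x hxD hx)
    have h2 : r ⟨x, hxD⟩ = χ x • LinearMap.id := by
      ext w
      exact (hW w).1 w.2 x hx
    rwa [h2, LinearMap.det_smul, LinearMap.det_id, mul_one] at h1
  have hχ1 : ∀ x ∈ ⁅D, D⁆, χ x = 1 := by
    intro x hx
    have h1 := (hD.commutator h𝓐) _ (hρ φ v) ?_ x hx
    · simpa [hφχ x hx, hφ] using h1
    · refine (Polynomial.nthRoots (Module.finrank K W) (1 : K)).toFinset.finite_toSet.subset ?_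
      rintro _ ⟨y, hy, rfl⟩
      simp only [hφχ y hy, Finset.mem_coe, Multiset.mem_toFinset]
      rw [Polynomial.mem_nthRoots Module.finrank_pos]
      exact hpow y hy
  obtain ⟨w, -, hw0, hw⟩ := exists_common_eigenvector_of_commute (fun g : D => ρ g) W
    (fun h => hv0 (by simpa [h] using hvW)) (fun g => hinv g g.2) (by
      rintro ⟨a, ha⟩ ⟨b, hb⟩ w hw
      have hc : ⁅a⁻¹, b⁻¹⁆ ∈ ⁅D, D⁆ :=
        Subgroup.commutator_mem_commutator (inv_mem ha) (inv_mem hb)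
      have h1 : ρ ⁅a⁻¹, b⁻¹⁆ w = w := by rw [(hW w).1 hw _ hc, hχ1 _ hc, one_smul]
      have h2 : b * a * ⁅a⁻¹, b⁻¹⁆ = a * b := by
        rw [commutatorElement_def]
        group
      simp only [← Module.End.mul_apply, ← map_mul]
      rw [← h2, map_mul (f := ρ) (b * a), Module.End.mul_apply, h1])
  exact ⟨w, hw0, fun x hx => hw ⟨x, hx⟩⟩

/-- The Lie–Kolchin theorem: a connected solvable group of matrices has a common
eigenvector. -/
theorem exists_common_eigenvector [IsAlgClosed K] [Nontrivial V] {𝓐 : Subalgebra K (Γ → K)}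
    (h𝓐 : ∀ f ∈ 𝓐, ∀ s y t, (fun x => f (s * (x * y * x⁻¹) * t)) ∈ 𝓐)
    (ρ : Γ →* Module.End K V)
    (hρ : ∀ (φ : Module.Dual K V) (v : V), (fun g => φ (ρ g v)) ∈ 𝓐)
    (hsolv : Group.IsSolvable Γ) (hΓ : IsConnectedFor 𝓐 (⊤ : Subgroup Γ)) :
    ∃ v : V, v ≠ 0 ∧ ∀ x, ∃ c : K, ρ x v = c • v := by
  obtain ⟨d, hd⟩ := hsolv.solvable
  have hconn : ∀ j, IsConnectedFor 𝓐 (derivedSeries Γ j) := by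
    intro j
    induction j with
    | zero => exact hΓ
    | succ j ih => exact ih.commutator h𝓐
  have key : ∀ j, ∃ v : V, v ≠ 0 ∧ ∀ x ∈ derivedSeries Γ (d - j), ∃ c : K, ρ x v = c • v := by
    intro j
    induction j with
    | zero =>
      obtain ⟨v, hv⟩ := exists_ne (0 : V)
      refine ⟨v, hv, fun x hx => ⟨1, ?_⟩⟩
      rw [Nat.sub_zero, hd, Subgroup.mem_bot] at hx
      simp [hx]
    | succ j ih =>
      by_cases hj : d - j = 0
      · rwa [Nat.sub_succ, hj, Nat.pred_zero, ← hj]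
      · have hs : d - j = (d - (j + 1)) + 1 := by omega
        rw [hs] at ih
        have := derivedSeries_normal Γ (d - (j + 1))
        exact exists_common_eigenvector_step h𝓐 ρ hρ (hconn _) ih
  obtain ⟨v, hv0, hv⟩ := key d
  refine ⟨v, hv0, fun x => hv x ?_⟩
  rw [Nat.sub_self]
  exact Subgroup.mem_top x

end LieKolchin

section Triangularization

variable {K : Type*} [Field K] {Γ : Type*} [Group Γ]

/-- The Lie–Kolchin theorem: a connected solvable group of operators stabilizes a complete
flag. -/
theorem exists_basis_triangular [IsAlgClosed K] {𝓐 : Subalgebra K (Γ → K)}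
    (h𝓐 : ∀ f ∈ 𝓐, ∀ s y t, (fun x => f (s * (x * y * x⁻¹) * t)) ∈ 𝓐)
    (hsolv : Group.IsSolvable Γ) (hΓ : IsConnectedFor 𝓐 (⊤ : Subgroup Γ)) (n : ℕ) :
    ∀ {V : Type*} [AddCommGroup V] [Module K V] [FiniteDimensional K V]
      (ρ : Γ →* Module.End K V)
      (_ : ∀ (φ : Module.Dual K V) (v : V), (fun g => φ (ρ g v)) ∈ 𝓐)
      (_ : Module.finrank K V = n),
      ∃ b : Module.Basis (Fin n) K V, ∀ g j, ρ g (b j) ∈ Submodule.span K (b '' Set.Iic j) := by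
  induction n with
  | zero =>
    intro V _ _ _ ρ _ hV
    exact ⟨Module.finBasisOfFinrankEq K V hV, fun g j => j.elim0⟩
  | succ n ih =>
    intro V _ _ _ ρ hρ hV
    have : Nontrivial V := Module.nontrivial_of_finrank_pos (R := K) (by omega)
    obtain ⟨v, hv0, hv⟩ := exists_common_eigenvector h𝓐 ρ hρ hsolv hΓ
    let W : Submodule K V := Submodule.span K {v}
    have hW : ∀ g, W ≤ W.comap (ρ g) := by
      intro g
      rw [Submodule.span_singleton_le_iff_mem, Submodule.mem_comap]
      obtain ⟨c, hc⟩ := hv g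
      rw [hc]
      exact Submodule.smul_mem _ _ (Submodule.mem_span_singleton_self v)
    let ρ' : Γ →* Module.End K (V ⧸ W) :=
      { toFun := fun g => W.mapQ W (ρ g) (hW g)
        map_one' := by
          ext x
          simp
        map_mul' := fun a b => by
          ext x
          simp }
    have hfr : Module.finrank K (V ⧸ W) = n := by
      have := Submodule.finrank_quotient_add_finrank W
      rw [finrank_span_singleton hv0] at this
      omega
    obtain ⟨c, hc⟩ := ih ρ' (by
      intro φ x
      obtain ⟨y, rfl⟩ := W.mkQ_surjective x
      exact hρ (φ.comp W.mkQ) y) hfr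
    let b₀ : Module.Basis (Fin 1 ⊕ Fin n) K V :=
      Module.Basis.sumQuot (Module.finBasisOfFinrankEq K W (finrank_span_singleton hv0)) c
    let σ : Fin 1 ⊕ Fin n ≃ Fin (n + 1) :=
      finSumFinEquiv.trans (finCongr (Nat.add_comm 1 n))
    have hσl : ∀ i, σ (Sum.inl i) = 0 := by
      intro i
      ext
      simp [σ]
    have hσr : ∀ i, σ (Sum.inr i) = Fin.succ i := by
      intro i
      ext
      simp [σ]
    have hb0 : b₀ (Sum.inl 0) ∈ W := by
      simp only [b₀, Module.Basis.sumQuot_inl]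
      exact Submodule.coe_mem _
    have hWb : ∀ w ∈ W, w ∈ Submodule.span K {b₀ (Sum.inl 0)} := by
      intro w hw
      obtain ⟨a, rfl⟩ := Submodule.mem_span_singleton.1 hw
      obtain ⟨a', ha'⟩ := Submodule.mem_span_singleton.1 hb0
      have : a' ≠ 0 := by
        rintro rfl
        exact b₀.ne_zero (Sum.inl 0) (by rw [← ha', zero_smul])
      refine Submodule.mem_span_singleton.2 ⟨a * a'⁻¹, ?_⟩
      rw [← ha', smul_smul, inv_mul_cancel_right₀ this]
    refine ⟨b₀.reindex σ, fun g j => ?_⟩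
    have hspan0 : ∀ w ∈ W, w ∈ Submodule.span K ((b₀.reindex σ) '' Set.Iic j) := by
      intro w hw
      refine Submodule.span_mono ?_ (hWb w hw)
      rw [Set.singleton_subset_iff]
      exact ⟨0, Fin.zero_le j, by rw [← hσl 0, Module.Basis.reindex_apply, Equiv.symm_apply_apply]⟩
    obtain ⟨i, rfl⟩ := σ.surjective j
    rw [Module.Basis.reindex_apply, Equiv.symm_apply_apply]
    rcases i with i | i
    · rw [Subsingleton.elim i 0]
      rw [Subsingleton.elim i 0] at hspan0
      exact hspan0 _ (hW g hb0)
    · have h1 := hc g i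
      have h2 : ∀ i, c i = W.mkQ (b₀ (Sum.inr i)) := fun i =>
        (Module.Basis.sumQuot_inr _ _ i).symm
      have h3 : W.mkQ (ρ g (b₀ (Sum.inr i))) ∈
          (Submodule.span K ((fun i => b₀ (Sum.inr i)) '' Set.Iic i)).map W.mkQ := by
        rw [Submodule.map_span, Set.image_image]
        simp only [← h2]
        have h4 : ρ' g (c i) = W.mkQ (ρ g (b₀ (Sum.inr i))) := by
          rw [h2]
          rfl
        rwa [← h4]
      obtain ⟨s, hs, hs'⟩ := h3
      have h5 : ρ g (b₀ (Sum.inr i)) - s ∈ W := by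
        rw [← Submodule.Quotient.eq]
        exact hs'.symm
      rw [← sub_add_cancel (ρ g (b₀ (Sum.inr i))) s]
      refine Submodule.add_mem _ (hspan0 _ h5) (Submodule.span_mono ?_ hs)
      rintro _ ⟨l, hl, rfl⟩
      refine ⟨σ (Sum.inr l), ?_, by simp⟩
      rw [Set.mem_Iic, hσr, hσr, Fin.succ_le_succ_iff]
      exact hl

attribute [local instance] zariskiTopology

theorem isConnectedFor_of_isConnected {N : ℕ}
    {B : Subgroup (Matrix.SpecialLinearGroup (Fin N) K)}
    (hB : IsConnected (B : Set (Matrix.SpecialLinearGroup (Fin N) K))) :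
    IsConnectedFor
      (regularFunctions fun g : B => slCoords (g : Matrix.SpecialLinearGroup (Fin N) K))
      ⊤ := by
  intro f hf hfin x _
  have hclosed : ∀ c : K, IsClosed {y : B | f y = c} := by
    intro c
    have h1 := (regularFunctions fun g : B =>
      slCoords (g : Matrix.SpecialLinearGroup (Fin N) K)).sub_mem hf
        (const_mem_regularFunctions _ c)
    have h2 := isOpen_ne_zero_of_regular (continuous_slCoords.comp continuous_subtype_val) h1
    rw [← isOpen_compl_iff]
    convert h2 using 1
    ext y
    simp [sub_eq_zero]
  have hopen : IsOpen {y : B | f y = f 1} := by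
    have : {y : B | f y = f 1} = (⋃ c ∈ f '' (⊤ : Subgroup B) \ {f 1}, {y : B | f y = c})ᶜ := by
      ext y
      simp only [Set.mem_ofPred_eq, Set.mem_compl_iff, Set.mem_iUnion, not_exists]
      constructor
      · rintro hy c ⟨-, hc⟩ rfl
        exact hc hy
      · intro hy
        by_contra hne
        exact hy (f y) ⟨⟨y, trivial, rfl⟩, hne⟩ rfl
    rw [this, isOpen_compl_iff]
    exact (hfin.sdiff).isClosed_biUnion fun c _ => hclosed c
  have : ConnectedSpace B := isConnected_iff_connectedSpace.1 hB
  have huniv := IsClopen.eq_univ ⟨hclosed (f 1), hopen⟩ ⟨1, rfl⟩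
  exact (Set.ext_iff.1 huniv x).2 trivial

/-- Connected solvable subgroups of `SL(N, K)` are simultaneously triangularizable. -/
theorem exists_conj_blockTriangular [IsAlgClosed K] {N : ℕ}
    {B : Subgroup (Matrix.SpecialLinearGroup (Fin N) K)}
    (hB : IsConnected (B : Set (Matrix.SpecialLinearGroup (Fin N) K)))
    (hsolv : Group.IsSolvable B) :
    ∃ P : Matrix (Fin N) (Fin N) K, IsUnit P.det ∧
      ∀ g ∈ B, (P * (g : Matrix (Fin N) (Fin N) K) * P⁻¹).BlockTriangular id := by
  let e := fun g : B => slCoords (g : Matrix.SpecialLinearGroup (Fin N) K)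
  let ρ : B →* Module.End K (Fin N → K) :=
    { toFun := fun g => Matrix.toLin' ((g : Matrix.SpecialLinearGroup (Fin N) K) : Matrix _ _ K)
      map_one' := by
        simp
        rfl
      map_mul' := fun a b => by
        simp [Matrix.toLin'_mul]
        rfl }
  have hreg : IsRegularMatrix e fun g : B =>
      ((g : Matrix.SpecialLinearGroup (Fin N) K) : Matrix (Fin N) (Fin N) K) :=
    isRegularMatrix_coe_sl _
  obtain ⟨b, hb⟩ := exists_basis_triangular (𝓐 := regularFunctions e) (by
    rintro f ⟨p, q, hpq⟩ s y t
    have hM : IsRegularMatrix e fun x : B =>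
        (((s * (x * y * x⁻¹) * t : B) : Matrix.SpecialLinearGroup (Fin N) K) :
          Matrix (Fin N) (Fin N) K) := by
      simp only [Subgroup.coe_mul, Subgroup.coe_inv, Matrix.SpecialLinearGroup.coe_mul,
        Matrix.SpecialLinearGroup.coe_inv]
      exact ((IsRegularMatrix.const _).mul ((hreg.mul (IsRegularMatrix.const _)).mul
        hreg.adjugate)).mul (IsRegularMatrix.const _)
    have h1 := eval_mem_regularFunctions (φ := fun x : B => e (s * (x * y * x⁻¹) * t))
      (fun j => hM j.1 j.2) p
    have h2 := eval_mem_regularFunctions (φ := fun x : B => e (s * (x * y * x⁻¹) * t))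
      (fun j => hM j.1 j.2) q
    have h3 := (regularFunctions e).mul_mem h1
      (inv_mem_regularFunctions h2 fun x => (hpq _).1)
    convert h3 using 1
    ext x
    rw [Pi.mul_apply, ← (hpq _).2, mul_inv_cancel_right₀ (hpq _).1]) hsolv
    (isConnectedFor_of_isConnected hB) N ρ (by
      intro φ v
      have h1 : (fun g => φ (ρ g v)) = fun g : B => ∑ i, (∑ j,
          ((g : Matrix.SpecialLinearGroup (Fin N) K) : Matrix (Fin N) (Fin N) K) i j * v j) *
            φ (Pi.single i 1) := by
        ext g
        rw [LinearMap.pi_apply_eq_sum_univ φ (ρ g v)]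
        refine Finset.sum_congr rfl fun i _ => congrArg₂ _ rfl (congrArg φ ?_)
        ext j
        simp [Pi.single_apply, eq_comm]
      rw [h1]
      exact sum_mem_regularFunctions _ fun i _ => (regularFunctions e).mul_mem
        (sum_mem_regularFunctions _ fun j _ => (regularFunctions e).mul_mem (hreg i j)
          (const_mem_regularFunctions e _)) (const_mem_regularFunctions e _)) (by simp)
  let P := b.toMatrix (Pi.basisFun K (Fin N))
  let Q := (Pi.basisFun K (Fin N)).toMatrix b
  have hPQ : P * Q = 1 := Module.Basis.toMatrix_mul_toMatrix_flip _ _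
  have hPinv : P⁻¹ = Q := Matrix.inv_eq_right_inv hPQ
  refine ⟨P, Matrix.isUnit_det_of_right_inverse hPQ, fun g hg => ?_⟩
  have h1 : P * (g : Matrix (Fin N) (Fin N) K) * P⁻¹ = LinearMap.toMatrix b b (ρ ⟨g, hg⟩) := by
    rw [hPinv]
    have := basis_toMatrix_mul_linearMap_toMatrix_mul_basis_toMatrix b (Pi.basisFun K (Fin N))
      b (Pi.basisFun K (Fin N)) (ρ ⟨g, hg⟩)
    rw [← this]
    congr 2
    ext i j
    simp [ρ]
  rw [h1]
  intro i j hij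
  rw [LinearMap.toMatrix_apply]
  have h2 := hb ⟨g, hg⟩ j
  rw [Module.Basis.mem_span_image] at h2
  by_contra hne
  have := h2 (Finsupp.mem_support_iff.2 hne)
  exact absurd hij (not_lt.2 this)

end Triangularization

section BorelSubgroup

variable {K : Type*} [Field K] {N : ℕ}

theorem mem_slBorel_iff {g : Matrix.SpecialLinearGroup (Fin N) K} :
    g ∈ slBorel K N ↔ (g : Matrix (Fin N) (Fin N) K).BlockTriangular id := by
  refine ⟨fun h => h.1, fun h => ⟨h, ?_⟩⟩
  have hinv : ((g⁻¹ : Matrix.SpecialLinearGroup (Fin N) K) : Matrix (Fin N) (Fin N) K) =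
      (g : Matrix (Fin N) (Fin N) K)⁻¹ := by
    rw [Matrix.SpecialLinearGroup.coe_inv, Matrix.inv_def, g.det_coe, Ring.inverse_one, one_smul]
  rw [hinv]
  have : Invertible (g : Matrix (Fin N) (Fin N) K) :=
    Matrix.invertibleOfIsUnitDet _ (by rw [g.det_coe]; exact isUnit_one)
  exact Matrix.blockTriangular_inv_of_blockTriangular h

/-- `M` has nonzero entries only on or above the `d`-th superdiagonal. -/
def SuperdiagonalLevel (d : ℕ) (M : Matrix (Fin N) (Fin N) K) : Prop :=
  ∀ i j : Fin N, (j : ℕ) < i + d → M i j = 0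

namespace SuperdiagonalLevel

variable {d e : ℕ} {A B : Matrix (Fin N) (Fin N) K}

theorem add (hA : SuperdiagonalLevel d A) (hB : SuperdiagonalLevel d B) :
    SuperdiagonalLevel d (A + B) := fun i j h => by
  rw [Matrix.add_apply, hA i j h, hB i j h, add_zero]

theorem sub (hA : SuperdiagonalLevel d A) (hB : SuperdiagonalLevel d B) :
    SuperdiagonalLevel d (A - B) := fun i j h => by
  rw [Matrix.sub_apply, hA i j h, hB i j h, sub_zero]

theorem mul (hA : SuperdiagonalLevel d A) (hB : SuperdiagonalLevel e B) :
    SuperdiagonalLevel (d + e) (A * B) := fun i j h => by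
  rw [Matrix.mul_apply]
  refine Finset.sum_eq_zero fun a _ => ?_
  by_cases ha : (a : ℕ) < i + d
  · rw [hA i a ha, zero_mul]
  · rw [hB a j (by omega), mul_zero]

theorem mono (hA : SuperdiagonalLevel d A) (h : e ≤ d) : SuperdiagonalLevel e A :=
  fun i j hij => hA i j (by omega)

theorem zero_one : SuperdiagonalLevel 0 (1 : Matrix (Fin N) (Fin N) K) := fun i j h =>
  Matrix.one_apply_ne (by rintro rfl; omega)

/-- Commutators of upper triangular matrices increase the superdiagonal level. -/
theorem mul_sub_mul (hA : SuperdiagonalLevel d (A - 1)) (hB : SuperdiagonalLevel d (B - 1)) :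
    SuperdiagonalLevel (d + 1) (A * B - B * A) := by
  have hcomm : A * B - B * A = (A - 1) * (B - 1) - (B - 1) * (A - 1) := by noncomm_ring
  rw [hcomm]
  rcases Nat.eq_zero_or_pos d with rfl | hd
  · intro i j hij
    have hdiag : ∀ C D : Matrix (Fin N) (Fin N) K, SuperdiagonalLevel 0 C →
        SuperdiagonalLevel 0 D → (C * D) i i = C i i * D i i := by
      intro C D hC hD
      rw [Matrix.mul_apply]
      refine Finset.sum_eq_single i (fun a _ ha => ?_) (by simp)
      rcases lt_or_gt_of_ne ha with h | h
      · rw [hC i a (by simpa using h), zero_mul]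
      · rw [hD a i (by simpa using h), mul_zero]
    rcases (show (j : ℕ) < i ∨ j = i by omega) with h | rfl
    · exact ((hA.mul hB).sub (hB.mul hA)) i j (by simpa using h)
    · rw [Matrix.sub_apply, hdiag _ _ hA hB, hdiag _ _ hB hA, mul_comm, sub_self]
  · exact ((hA.mul hB).sub (hB.mul hA)).mono (by omega)

end SuperdiagonalLevel

theorem superdiagonalLevel_zero_of_mem {g : Matrix.SpecialLinearGroup (Fin N) K}
    (hg : g ∈ slBorel K N) : SuperdiagonalLevel 0 (g : Matrix (Fin N) (Fin N) K) :=
  fun _ _ h => hg.1 (by simpa using h)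

/-- The upper triangular matrices that agree with the identity below the `d`-th
superdiagonal. -/
def slBorelLevel (d : ℕ) : Subgroup (slBorel K N) where
  carrier := {g | SuperdiagonalLevel d (g.1.1 - 1) ∧ SuperdiagonalLevel d (g⁻¹.1.1 - 1)}
  one_mem' := by
    have h : SuperdiagonalLevel d (0 : Matrix (Fin N) (Fin N) K) := fun _ _ _ => rfl
    simpa using h
  mul_mem' := by
    have key : ∀ a b : slBorel K N, SuperdiagonalLevel d (a.1.1 - 1) →
        SuperdiagonalLevel d (b.1.1 - 1) → SuperdiagonalLevel d ((a * b).1.1 - 1) := by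
      intro a b ha hb
      have h : (a * b).1.1 - 1 = (a.1.1 - 1) * b.1.1 + (b.1.1 - 1) := by
        rw [Subgroup.coe_mul, sub_mul, one_mul, sub_add_sub_cancel]
        rfl
      rw [h]
      exact (ha.mul (superdiagonalLevel_zero_of_mem b.2)).add hb
    rintro a b ⟨ha, ha'⟩ ⟨hb, hb'⟩
    refine ⟨key a b ha hb, ?_⟩
    rw [mul_inv_rev]
    exact key _ _ hb' ha'
  inv_mem' := by
    rintro a ⟨ha, ha'⟩
    exact ⟨ha', by rwa [inv_inv]⟩

open scoped commutatorElement in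
theorem isSolvable_slBorel : Group.IsSolvable (slBorel K N) := by
  have key : ∀ d, derivedSeries (slBorel K N) d ≤ slBorelLevel d := by
    intro d
    induction d with
    | zero =>
      intro g _
      exact ⟨(superdiagonalLevel_zero_of_mem g.2).sub .zero_one,
        (superdiagonalLevel_zero_of_mem (g⁻¹).2).sub .zero_one⟩
    | succ d ih =>
      rw [derivedSeries_succ, Subgroup.commutator_le]
      have comm : ∀ a ∈ slBorelLevel (K := K) (N := N) d, ∀ b ∈ slBorelLevel d,
          SuperdiagonalLevel (d + 1) ((⁅a, b⁆ : slBorel K N).1.1 - 1) := by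
        intro a ha b hb
        have h : (⁅a, b⁆ : slBorel K N).1.1 - 1 =
            (a.1.1 * b.1.1 - b.1.1 * a.1.1) * ((b * a)⁻¹ : slBorel K N).1.1 := by
          have h2 : b.1.1 * a.1.1 * ((b * a)⁻¹ : slBorel K N).1.1 = 1 :=
            congrArg (fun x : slBorel K N => x.1.1) (mul_inv_cancel (b * a))
          have h3 : (⁅a, b⁆ : slBorel K N) = a * b * (b * a)⁻¹ := by
            rw [commutatorElement_def]
            group
          rw [sub_mul, h2, h3]
          rfl
        rw [h]
        exact (ha.1.mul_sub_mul hb.1).mul (superdiagonalLevel_zero_of_mem ((b * a)⁻¹).2)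
      intro a ha b hb
      refine ⟨comm a (ih ha) b (ih hb), ?_⟩
      rw [commutatorElement_inv]
      exact comm b (ih hb) a (ih ha)
  refine (Group.isSolvable_def _).2 ⟨N, (Subgroup.eq_bot_iff_forall _).2 fun g hg => ?_⟩
  ext i j
  have := (key N hg).1 i j (by omega)
  exact sub_eq_zero.1 this

attribute [local instance] zariskiTopology

theorem isIrreducible_ne_zero_of_regular [Infinite K] {ι : Type*} {f : (ι → K) → K}
    (hf : f ∈ regularFunctions (id : (ι → K) → ι → K)) (hne : ∃ x, f x ≠ 0) :
    IsIrreducible {x | f x ≠ 0} := by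
  obtain ⟨p, q, h⟩ := hf
  have heq : {x | f x ≠ 0} = {v | MvPolynomial.eval v p ≠ 0} := by
    ext x
    rw [Set.mem_ofPred_eq, Set.mem_ofPred_eq, ← id_eq x, ← (h x).2, mul_ne_zero_iff]
    exact ⟨fun hx => ⟨hx, (h x).1⟩, fun hx => hx.1⟩
  rw [heq]
  refine isIrreducible_zariski_ne_zero ?_
  rintro rfl
  obtain ⟨x, hx⟩ := hne
  have : x ∈ {x | f x ≠ 0} := hx
  rw [heq] at this
  simp at this

theorem isClosed_slBorel :
    IsClosed (slBorel K N : Set (Matrix.SpecialLinearGroup (Fin N) K)) := by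
  have : (slBorel K N : Set (Matrix.SpecialLinearGroup (Fin N) K)) =
      ⋂ (i : Fin N) (j : Fin N) (_ : j < i),
        {g : Matrix.SpecialLinearGroup (Fin N) K | (g : Matrix _ _ K) i j ≠ 0}ᶜ := by
    ext g
    rw [SetLike.mem_coe, mem_slBorel_iff]
    simp [Matrix.BlockTriangular]
  rw [this]
  refine isClosed_iInter fun i => isClosed_iInter fun j => isClosed_iInter fun _ => ?_
  exact (isOpen_ne_zero_of_regular continuous_slCoords
    (isRegularMatrix_coe_sl id i j)).isClosed_compl

theorem isIrreducible_slBorel [Infinite K] (n : ℕ) :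
    IsIrreducible (slBorel K (n + 1) : Set (Matrix.SpecialLinearGroup (Fin (n + 1)) K)) := by
  let up : (Fin (n + 1) × Fin (n + 1) → K) → Matrix (Fin (n + 1)) (Fin (n + 1)) K := fun v =>
    Matrix.of fun i j => if i ≤ j then v (i, j) else 0
  have hup : ∀ v, (up v).BlockTriangular id := fun v i j hij => if_neg (not_le.2 hij)
  have hreg : IsRegularMatrix id up := by
    intro i j
    by_cases h : i ≤ j
    · simpa [up, h] using!
        coord_mem_regularFunctions (id : (Fin (n + 1) × Fin (n + 1) → K) → _) (i, j)
    · simpa [up, h] using! const_mem_regularFunctions (id : (Fin (n + 1) × Fin (n + 1) → K) → _) 0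
  let D : (Fin (n + 1) × Fin (n + 1) → K) → Matrix (Fin (n + 1)) (Fin (n + 1)) K := fun v =>
    Matrix.diagonal (Function.update 1 0 (up v).det⁻¹)
  let Y := {v | (up v).det ≠ 0}
  have hY : IsIrreducible Y := isIrreducible_ne_zero_of_regular hreg.det
    ⟨fun p => (1 : Matrix (Fin (n + 1)) (Fin (n + 1)) K) p.1 p.2, by
      have : up (fun p => (1 : Matrix (Fin (n + 1)) (Fin (n + 1)) K) p.1 p.2) = 1 := by
        ext i j
        by_cases h : i ≤ j
        · simp [up, h]
        · simp [up, h, Matrix.one_apply_ne (fun h' : i = j => h h'.le)]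
      rw [this]
      simp⟩
  have hdet : ∀ v : Y, (D v * up v).det = 1 := by
    intro v
    rw [Matrix.det_mul, Matrix.det_diagonal, Fin.prod_univ_succ]
    simpa using inv_mul_cancel₀ v.2
  let φ : Y → Matrix.SpecialLinearGroup (Fin (n + 1)) K := fun v => ⟨D v * up v, hdet v⟩
  have hregY : IsRegularMatrix (fun v : Y => (v : Fin (n + 1) × Fin (n + 1) → K))
      fun v : Y => up v := by
    intro i j
    obtain ⟨p, q, h⟩ := hreg i j
    exact ⟨p, q, fun x => h x⟩
  have hφ : Continuous φ := by
    refine continuous_sl_of_regular (e := fun v : Y => (v : Fin (n + 1) × Fin (n + 1) → K))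
      continuous_subtype_val (IsRegularMatrix.mul ?_ hregY)
    intro i j
    by_cases hij : i = j
    · subst hij
      by_cases hi : i = 0
      · subst hi
        simpa [D] using! inv_mem_regularFunctions hregY.det fun v => v.2
      · simpa [D, hi] using! const_mem_regularFunctions _ 1
    · simpa [D, hij] using! const_mem_regularFunctions _ 0
  have himg : φ '' Set.univ = slBorel K (n + 1) := by
    ext g
    rw [SetLike.mem_coe, mem_slBorel_iff]
    constructor
    · rintro ⟨v, -, rfl⟩
      exact (Matrix.blockTriangular_diagonal _).mul (hup v)
    · intro hg
      have hgup : up (slCoords g) = g := by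
        ext i j
        by_cases h : i ≤ j
        · simp [up, h, slCoords]
        · simpa [up, h] using (hg (not_le.1 h)).symm
      refine ⟨⟨slCoords g, by simp [Y, hgup]⟩, trivial, ?_⟩
      ext i j
      simp [φ, D, hgup]
  rw [← himg]
  have : IrreducibleSpace Y := isIrreducible_iff_irreducibleSpace.1 hY
  exact (IrreducibleSpace.isIrreducible_univ Y).image φ hφ.continuousOn

/-- A conjugate of the upper triangular group is upper triangular only for a conjugating
matrix that is itself upper triangular. -/
theorem blockTriangular_of_conj_slBorel {P : Matrix (Fin N) (Fin N) K} (hP : IsUnit P.det)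
    (h : ∀ g ∈ slBorel K N, (P * (g : Matrix (Fin N) (Fin N) K) * P⁻¹).BlockTriangular id) :
    P.BlockTriangular id := by
  have hinv : Invertible P := Matrix.invertibleOfIsUnitDet P hP
  have key : ∀ a c p q : Fin N, a < c → q < p → P p a * P⁻¹ c q = 0 := by
    intro a c p q hac hqp
    let g : Matrix.SpecialLinearGroup (Fin N) K :=
      ⟨Matrix.transvection a c 1, Matrix.det_transvection_of_ne a c hac.ne 1⟩
    have hg : g ∈ slBorel K N := by
      rw [mem_slBorel_iff]
      exact Matrix.blockTriangular_transvection hac.le 1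
    have h1 := h g hg (show id q < id p from hqp)
    have h2 : P * (g : Matrix (Fin N) (Fin N) K) * P⁻¹ = 1 + P * Matrix.single a c 1 * P⁻¹ := by
      change P * (1 + Matrix.single a c 1) * P⁻¹ = _
      rw [mul_add, add_mul, mul_one, Matrix.mul_nonsing_inv _ hP]
    rw [h2, Matrix.add_apply, Matrix.one_apply_ne hqp.ne', zero_add] at h1
    rw [← h1, Matrix.mul_apply, Finset.sum_eq_single c]
    · simp
    · intro b _ hb
      simp [hb]
    · simp
  intro p a hap
  by_contra hne
  let b : Fin N → ℕ := fun x => if x ≤ a then 0 else 1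
  have hblock : P⁻¹.BlockTriangular b := by
    intro c q hqc
    have hc : a < c := by
      by_contra hc
      simp [b, not_lt.1 hc] at hqc
    have hq : q ≤ a := by
      by_contra hq
      simp only [b, hq, if_false] at hqc
      split_ifs at hqc <;> omega
    exact (mul_eq_zero.1 (key a c p q hc (hq.trans_lt hap))).resolve_left hne
  have : Invertible P⁻¹ := Matrix.invertibleOfIsUnitDet _ (Matrix.isUnit_nonsing_inv_det P hP)
  have h3 := Matrix.blockTriangular_inv_of_blockTriangular hblock
  rw [Matrix.nonsing_inv_nonsing_inv P hP] at h3
  refine hne (h3 ?_)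
  have hp : ¬ p ≤ a := not_le.2 hap
  simp [b, hp]

/-- The upper triangular group is a Borel subgroup of `SL(n + 1, K)`. -/
theorem isBorel_slBorel [IsAlgClosed K] (n : ℕ) :
    IsBorel (Matrix.SpecialLinearGroup (Fin (n + 1)) K) (slBorel K (n + 1)) := by
  have : Infinite K := IsAlgClosed.instInfinite
  refine ⟨isClosed_slBorel, (isIrreducible_slBorel n).isConnected, isSolvable_slBorel, ?_⟩
  intro B' _ hconn hsolv hle
  refine le_antisymm (fun g hg => ?_) hle
  obtain ⟨P, hP, hB'⟩ := exists_conj_blockTriangular hconn hsolv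
  have hPt := blockTriangular_of_conj_slBorel hP fun g hg => hB' g (hle hg)
  have hinv : Invertible P := Matrix.invertibleOfIsUnitDet P hP
  rw [mem_slBorel_iff]
  have h1 := ((Matrix.blockTriangular_inv_of_blockTriangular hPt).mul (hB' g hg)).mul hPt
  rwa [Matrix.mul_assoc P, Matrix.nonsing_inv_mul_cancel_left _ _ hP,
    Matrix.mul_assoc, Matrix.nonsing_inv_mul _ hP, mul_one] at h1

end BorelSubgroup

section NonSpherical

variable {K : Type*} [Field K]

/-- An invertible matrix can be rescaled to have determinant `1`. -/
theorem exists_sl_eq_smul [IsAlgClosed K] {n : ℕ} {g : Matrix (Fin (n + 1)) (Fin (n + 1)) K}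
    (hg : IsUnit g.det) :
    ∃ (c : K) (g' : Matrix.SpecialLinearGroup (Fin (n + 1)) K), g'.1 = c • g := by
  obtain ⟨c, hc⟩ := IsAlgClosed.exists_pow_nat_eq (g.det⁻¹) n.succ_pos
  refine ⟨c, ⟨c • g, ?_⟩, rfl⟩
  rw [Matrix.det_smul, Fintype.card_fin, hc, inv_mul_cancel₀ hg.ne_zero]

theorem eq_conj_of_eq_smul {n : ℕ} {u v g' : Matrix.SpecialLinearGroup (Fin (n + 1)) K}
    {g : Matrix (Fin (n + 1)) (Fin (n + 1)) K} {c : K} (hg' : g'.1 = c • g)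
    (h : g * u.1 = v.1 * g) : v = g' * u * g'⁻¹ := by
  have : g' * u = v * g' := by
    refine Subtype.ext ?_
    change g'.1 * u.1 = v.1 * g'.1
    rw [hg', Matrix.smul_mul, Matrix.mul_smul, h]
  rw [this, mul_inv_cancel_right]

/-- Conjugacy under `GL(n + 1, K)` implies conjugacy under `SL(n + 1, K)`. -/
theorem isConj_of_mul_eq_mul [IsAlgClosed K] {n : ℕ}
    {u v : Matrix.SpecialLinearGroup (Fin (n + 1)) K} {g : Matrix (Fin (n + 1)) (Fin (n + 1)) K}
    (hg : IsUnit g.det) (h : g * u.1 = v.1 * g) : IsConj u v := by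
  obtain ⟨c, g', hg'⟩ := exists_sl_eq_smul hg
  exact isConj_iff.2 ⟨g', (eq_conj_of_eq_smul hg' h).symm⟩

theorem exists_linearEquiv_apply_eq {ι V : Type*} [AddCommGroup V] [Module K V]
    [FiniteDimensional K V] {v w : ι → V} (hv : LinearIndependent K v)
    (hw : LinearIndependent K w) : ∃ g : V ≃ₗ[K] V, ∀ i, g (v i) = w i := by
  obtain ⟨g, hg⟩ := Submodule.exists_linearEquiv_restrict_eq
    ((Module.Basis.span hv).equiv (Module.Basis.span hw) (Equiv.refl ι))
  refine ⟨g, fun i => ?_⟩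
  have h := hg (Module.Basis.span hv i)
  rw [Module.Basis.equiv_apply, Equiv.refl_apply, Module.Basis.span_apply,
    Module.Basis.span_apply] at h
  exact h.symm

/-- Linearly independent vectors can be prescribed as columns of an invertible matrix. -/
theorem exists_matrix_mulVec_single {ι : Type*} {N : ℕ} {pos : ι → Fin N}
    (hpos : Function.Injective pos) {w : ι → Fin N → K} (hw : LinearIndependent K w) :
    ∃ G : Matrix (Fin N) (Fin N) K, IsUnit G.det ∧
      ∀ i, G⁻¹ *ᵥ w i = Pi.single (pos i) 1 ∧ G *ᵥ Pi.single (pos i) 1 = w i := by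
  have hv : LinearIndependent K fun i => (Pi.single (pos i) 1 : Fin N → K) := by
    have := (Pi.basisFun K (Fin N)).linearIndependent.comp pos hpos
    convert this using 1
    ext i
    simp
  obtain ⟨g, hg⟩ := exists_linearEquiv_apply_eq hv hw
  have hdet : IsUnit (LinearMap.toMatrix' (g : (Fin N → K) →ₗ[K] Fin N → K)).det := by
    rw [LinearMap.det_toMatrix']
    exact g.isUnit_det'
  have h2 : ∀ i, LinearMap.toMatrix' (g : (Fin N → K) →ₗ[K] Fin N → K) *ᵥ
      Pi.single (pos i) 1 = w i := fun i => by
    rw [← Matrix.toLin'_apply, Matrix.toLin'_toMatrix']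
    exact hg i
  refine ⟨_, hdet, fun i => ⟨?_, h2 i⟩⟩
  rw [← h2 i, Matrix.mulVec_mulVec, Matrix.nonsing_inv_mul _ hdet, Matrix.one_mulVec]

theorem exists_mulVec_of_isNilpotent {N : ℕ} {M : Matrix (Fin N) (Fin N) K}
    (hM : IsNilpotent M) (h2 : M ^ 2 ≠ 0) :
    ∃ w : Fin N → K, LinearIndependent K ![w, M *ᵥ w, M *ᵥ (M *ᵥ w)] := by
  have hex : ∃ m, M ^ m = 0 := hM
  have h3 : 3 ≤ Nat.find hex := by
    by_contra h
    exact h2 (pow_eq_zero_of_le (show Nat.find hex ≤ 2 by omega) (Nat.find_spec hex))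
  obtain ⟨m, hm⟩ := Nat.exists_eq_add_of_le h3
  have hm1 : M ^ (2 + m) ≠ 0 := Nat.find_min hex (by omega)
  have hm2 : M ^ (3 + m) = 0 := hm ▸ Nat.find_spec hex
  obtain ⟨v, hv⟩ : ∃ v, M ^ (2 + m) *ᵥ v ≠ 0 := by
    by_contra! h
    exact hm1 (Matrix.ext_of_mulVec_single fun i => by rw [h, Matrix.zero_mulVec])
  refine ⟨M ^ m *ᵥ v, ?_⟩
  set w := M ^ m *ᵥ v with hw
  have hw2 : M *ᵥ (M *ᵥ w) ≠ 0 := by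
    rwa [hw, Matrix.mulVec_mulVec, Matrix.mulVec_mulVec, ← pow_two, ← pow_add]
  have hw3 : M *ᵥ (M *ᵥ (M *ᵥ w)) = 0 := by
    rw [hw, Matrix.mulVec_mulVec, Matrix.mulVec_mulVec, Matrix.mulVec_mulVec, ← pow_two,
      ← pow_succ, ← pow_add, hm2, Matrix.zero_mulVec]
  rw [Fintype.linearIndependent_iff]
  intro a ha
  simp only [Fin.sum_univ_three, Matrix.cons_val_zero, Matrix.cons_val_one,
    Matrix.cons_val_two, Matrix.tail_cons, Matrix.head_cons] at ha
  have ha1 := congrArg (fun x => M *ᵥ x) ha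
  have ha2 := congrArg (fun x => M *ᵥ x) ha1
  simp only [Matrix.mulVec_add, Matrix.mulVec_smul, hw3, smul_zero, Matrix.mulVec_zero, add_zero]
    at ha1 ha2
  have h0 : a 0 = 0 := (smul_eq_zero.1 ha2).resolve_right hw2
  rw [h0, zero_smul, zero_add] at ha1
  have h1 : a 1 = 0 := (smul_eq_zero.1 ha1).resolve_right hw2
  rw [h0, h1, zero_smul, zero_smul, zero_add, zero_add] at ha
  have h2' : a 2 = 0 := (smul_eq_zero.1 ha).resolve_right hw2
  intro i
  fin_cases i
  exacts [h0, h1, h2']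

/-- If `M` is nilpotent with `M ^ 2 ≠ 0`, the corner entries of `M` and `M ^ 2` can be
prescribed to be `(0, 1)` or `(1, 0)` by conjugation. -/
theorem exists_conj_corner_entries {n : ℕ} {M : Matrix (Fin (n + 1)) (Fin (n + 1)) K}
    (hM : IsNilpotent M) (h2 : M ^ 2 ≠ 0) :
    (∃ G : Matrix (Fin (n + 1)) (Fin (n + 1)) K, IsUnit G.det ∧
      (G⁻¹ * M * G) (Fin.last n) 0 = 0 ∧ (G⁻¹ * M ^ 2 * G) (Fin.last n) 0 = 1) ∧
    ∃ G : Matrix (Fin (n + 1)) (Fin (n + 1)) K, IsUnit G.det ∧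
      (G⁻¹ * M * G) (Fin.last n) 0 = 1 ∧ (G⁻¹ * M ^ 2 * G) (Fin.last n) 0 = 0 := by
  obtain ⟨w, hw⟩ := exists_mulVec_of_isNilpotent hM h2
  have hn : 2 ≤ n := by
    have := hw.fintype_card_le_finrank
    simp at this
    omega
  have hval : ∀ (G A : Matrix (Fin (n + 1)) (Fin (n + 1)) K),
      (G⁻¹ * A * G) (Fin.last n) 0 =
        (G⁻¹ *ᵥ (A *ᵥ (G *ᵥ Pi.single (0 : Fin (n + 1)) 1))) (Fin.last n) := by
    intro G A
    rw [Matrix.mulVec_mulVec, Matrix.mulVec_mulVec, Matrix.mulVec_single_one]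
    rfl
  have h01 : (0 : Fin (n + 1)) ≠ ⟨1, by omega⟩ := by simp [Fin.ext_iff]
  have h0l : (0 : Fin (n + 1)) ≠ Fin.last n := by
    rw [Ne, Fin.ext_iff, Fin.val_last]
    simp
    omega
  have h1l : (⟨1, by omega⟩ : Fin (n + 1)) ≠ Fin.last n := by
    rw [Ne, Fin.ext_iff, Fin.val_last]
    simp
    omega
  constructor
  · obtain ⟨G, hG, hG'⟩ := exists_matrix_mulVec_single
      (pos := ![(0 : Fin (n + 1)), ⟨1, by omega⟩, Fin.last n]) (by
        intro i j
        fin_cases i <;> fin_cases j <;> simp_all [eq_comm]) hw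
    have h0 := (hG' 0).2
    have h1 := (hG' 1).1
    have h2 := (hG' 2).1
    simp only [Matrix.cons_val_zero, Matrix.cons_val_one, Matrix.cons_val] at h0 h1 h2
    refine ⟨G, hG, ?_, ?_⟩
    · rw [hval, h0, h1, Pi.single_eq_of_ne h1l.symm]
    · rw [hval, h0, pow_two, ← Matrix.mulVec_mulVec, h2, Pi.single_eq_same]
  · obtain ⟨G, hG, hG'⟩ := exists_matrix_mulVec_single
      (pos := ![(0 : Fin (n + 1)), Fin.last n, ⟨1, by omega⟩]) (by
        intro i j
        fin_cases i <;> fin_cases j <;> simp_all [eq_comm]) hw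
    have h0 := (hG' 0).2
    have h1 := (hG' 1).1
    have h2 := (hG' 2).1
    simp only [Matrix.cons_val_zero, Matrix.cons_val_one, Matrix.cons_val] at h0 h1 h2
    refine ⟨G, hG, ?_, ?_⟩
    · rw [hval, h0, h1, Pi.single_eq_same]
    · rw [hval, h0, pow_two, ← Matrix.mulVec_mulVec, h2, Pi.single_eq_of_ne h1l.symm]

theorem blockTriangular_corner_entry {n : ℕ} {S M T : Matrix (Fin (n + 1)) (Fin (n + 1)) K}
    (hS : S.BlockTriangular id) (hT : T.BlockTriangular id) :
    (S * M * T) (Fin.last n) 0 = S (Fin.last n) (Fin.last n) * T 0 0 * M (Fin.last n) 0 := by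
  rw [Matrix.mul_apply, Finset.sum_eq_single 0, Matrix.mul_apply,
    Finset.sum_eq_single (Fin.last n)]
  · ring
  · intro b _ hb
    rw [hS (show id b < id (Fin.last n) from Fin.lt_last_iff_ne_last.2 hb), zero_mul]
  · simp
  · intro b _ hb
    rw [hT (show id 0 < id b from Fin.pos_iff_ne_zero.2 hb), mul_zero]
  · simp

attribute [local instance] zariskiTopology

theorem isClosed_eq_zero_of_regular {X ι : Type*} [TopologicalSpace X] {e : X → ι → K}
    (he : Continuous e) {f : X → K} (hf : f ∈ regularFunctions e) : IsClosed {x | f x = 0} := by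
  rw [← isOpen_compl_iff]
  exact isOpen_ne_zero_of_regular he hf

/-- Two semi-invariants of the same weight are proportional on the closure of an orbit. -/
theorem mul_eq_mul_of_mem_closure {X ι : Type*} [TopologicalSpace X] {e : X → ι → K}
    (he : Continuous e) {p q : X → K} (hp : p ∈ regularFunctions e) (hq : q ∈ regularFunctions e)
    {S : Set X} {x : X} (hS : ∀ v ∈ S, ∃ c, p v = c * p x ∧ q v = c * q x) :
    ∀ v ∈ closure S, ∀ w ∈ closure S, p v * q w = q v * p w := by
  have key : ∀ a b : K, a * p x - b * q x = 0 → ∀ v ∈ closure S, a * p v - b * q v = 0 := by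
    intro a b hab
    refine closure_minimal (fun v hv => ?_) (isClosed_eq_zero_of_regular he
      ((regularFunctions e).sub_mem
        ((regularFunctions e).mul_mem (const_mem_regularFunctions e a) hp)
        ((regularFunctions e).mul_mem (const_mem_regularFunctions e b) hq)))
    obtain ⟨c, hpc, hqc⟩ := hS v hv
    change a * p v - b * q v = 0
    rw [hpc, hqc]
    linear_combination c * hab
  intro v hv w hw
  have hv1 := key (q x) (p x) (by ring) v hv
  have hw1 := key (q x) (p x) (by ring) w hw
  by_cases hx : p x = 0
  · have hp0 : ∀ v ∈ closure S, p v = 0 := fun v hv => by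
      simpa using key 1 0 (by rw [hx]; ring) v hv
    rw [hp0 v hv, hp0 w hw, zero_mul, mul_zero]
  · refine mul_left_cancel₀ hx ?_
    linear_combination p w * hv1 - p v * hw1

/-- In a spherical unipotent class of `SL(n + 1, K)` all Jordan blocks have size at
most `2`. -/
theorem sq_eq_zero_of_isSphericalClass [IsAlgClosed K] {n : ℕ}
    {u : Matrix.SpecialLinearGroup (Fin (n + 1)) K}
    (hu : IsNilpotent ((u : Matrix (Fin (n + 1)) (Fin (n + 1)) K) - 1))
    (h : IsSphericalClass (Matrix.SpecialLinearGroup (Fin (n + 1)) K) (conjClass u)) :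
    ((u : Matrix (Fin (n + 1)) (Fin (n + 1)) K) - 1) ^ 2 = 0 := by
  by_contra hsq
  obtain ⟨B, ⟨-, hconn, hsolv, -⟩, x, -, hdense⟩ := h
  obtain ⟨P, hP, hPB⟩ := exists_conj_blockTriangular hconn hsolv
  let A : Matrix.SpecialLinearGroup (Fin (n + 1)) K → Matrix (Fin (n + 1)) (Fin (n + 1)) K :=
    fun v => P * ((v : Matrix _ _ K) - 1) * P⁻¹
  have hA : IsRegularMatrix slCoords A :=
    ((IsRegularMatrix.const P).mul ((isRegularMatrix_coe_sl id).sub (IsRegularMatrix.const 1))).mul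
      (IsRegularMatrix.const P⁻¹)
  have horbit : ∀ v ∈ conjOrbit B x, ∃ c, (A v * A v) (Fin.last n) 0 =
      c * (A x * A x) (Fin.last n) 0 ∧ A v (Fin.last n) 0 = c * A x (Fin.last n) 0 := by
    rintro _ ⟨b, hb, rfl⟩
    have hbb : (b : Matrix (Fin (n + 1)) (Fin (n + 1)) K) *
        ((b⁻¹ : Matrix.SpecialLinearGroup (Fin (n + 1)) K) : Matrix _ _ K) = 1 := by
      rw [← Matrix.SpecialLinearGroup.coe_mul, mul_inv_cancel, Matrix.SpecialLinearGroup.coe_one]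
    have hbb' : ((b⁻¹ : Matrix.SpecialLinearGroup (Fin (n + 1)) K) : Matrix _ _ K) *
        (b : Matrix (Fin (n + 1)) (Fin (n + 1)) K) = 1 := by
      rw [← Matrix.SpecialLinearGroup.coe_mul, inv_mul_cancel, Matrix.SpecialLinearGroup.coe_one]
    have hPP := Matrix.nonsing_inv_mul P hP
    have hS := hPB b hb
    have hT := hPB b⁻¹ (B.inv_mem hb)
    set b₁ : Matrix (Fin (n + 1)) (Fin (n + 1)) K := b.1
    set b₂ : Matrix (Fin (n + 1)) (Fin (n + 1)) K := (b⁻¹).1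
    have hconj : A (b * x * b⁻¹) = (P * b₁ * P⁻¹) * A x * (P * b₂ * P⁻¹) := by
      have h1 : ((b * x * b⁻¹ : Matrix.SpecialLinearGroup (Fin (n + 1)) K) : Matrix _ _ K) - 1 =
          b₁ * ((x : Matrix _ _ K) - 1) * b₂ := by
        rw [mul_sub, sub_mul, mul_one, hbb, Matrix.SpecialLinearGroup.coe_mul,
          Matrix.SpecialLinearGroup.coe_mul]
      simp only [A]
      rw [h1]
      simp only [Matrix.mul_assoc, Matrix.nonsing_inv_mul_cancel_left _ _ hP]
    have hTS : (P * b₂ * P⁻¹) * (P * b₁ * P⁻¹) = 1 := by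
      rw [show (P * b₂ * P⁻¹) * (P * b₁ * P⁻¹) = P * (b₂ * (P⁻¹ * P) * b₁) * P⁻¹ by
        simp only [Matrix.mul_assoc], hPP, mul_one, hbb', mul_one, Matrix.mul_nonsing_inv _ hP]
    have hconj2 : A (b * x * b⁻¹) * A (b * x * b⁻¹) =
        (P * b₁ * P⁻¹) * (A x * A x) * (P * b₂ * P⁻¹) := by
      rw [hconj]
      generalize P * b₁ * P⁻¹ = S at *
      generalize P * b₂ * P⁻¹ = T at *
      rw [show S * A x * T * (S * A x * T) = S * (A x * (T * S) * A x) * T by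
        simp only [Matrix.mul_assoc], hTS, mul_one]
    rw [hconj2, hconj, blockTriangular_corner_entry hS hT, blockTriangular_corner_entry hS hT]
    exact ⟨_, rfl, rfl⟩
  have hreal : ∀ G : Matrix (Fin (n + 1)) (Fin (n + 1)) K, IsUnit G.det →
      ∃ v ∈ conjClass u, A v (Fin.last n) 0 = (G⁻¹ * (u.1 - 1) * G) (Fin.last n) 0 ∧
        (A v * A v) (Fin.last n) 0 =
          (G⁻¹ * (u.1 - 1) ^ 2 * G : Matrix (Fin (n + 1)) (Fin (n + 1)) K) (Fin.last n) 0 := by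
    intro G hG
    have hPP := Matrix.mul_nonsing_inv P hP
    have hPP' := Matrix.nonsing_inv_mul P hP
    have hGG := Matrix.mul_nonsing_inv G hG
    have hGG' := Matrix.nonsing_inv_mul G hG
    let v : Matrix.SpecialLinearGroup (Fin (n + 1)) K :=
      ⟨P⁻¹ * G⁻¹ * (u : Matrix _ _ K) * (G * P), by
        have h1 : P⁻¹.det * G⁻¹.det * (G.det * P.det) = 1 := by
          rw [← Matrix.det_mul, ← Matrix.det_mul, ← Matrix.det_mul, Matrix.mul_assoc,
            Matrix.nonsing_inv_mul_cancel_left _ _ hG, hPP', Matrix.det_one]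
        rw [Matrix.det_mul, Matrix.det_mul, Matrix.det_mul, Matrix.det_mul, u.det_coe, mul_one, h1]⟩
    have hAv : A v = G⁻¹ * ((u : Matrix _ _ K) - 1) * G := by
      change P * (P⁻¹ * G⁻¹ * (u : Matrix _ _ K) * (G * P) - 1) * P⁻¹ = _
      rw [mul_sub, sub_mul, mul_sub, sub_mul, mul_one, mul_one, hPP, hGG']
      simp only [Matrix.mul_assoc, hPP, mul_one, Matrix.mul_nonsing_inv_cancel_left _ _ hP]
    refine ⟨v, isConj_of_mul_eq_mul (g := P⁻¹ * G⁻¹) ?_ ?_, ?_, ?_⟩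
    · rw [Matrix.det_mul]
      exact (Matrix.isUnit_nonsing_inv_det _ hP).mul (Matrix.isUnit_nonsing_inv_det _ hG)
    · change _ = P⁻¹ * G⁻¹ * (u : Matrix _ _ K) * (G * P) * (P⁻¹ * G⁻¹)
      simp only [Matrix.mul_assoc, Matrix.mul_nonsing_inv_cancel_left _ _ hP, hGG, mul_one]
    · rw [hAv]
    · rw [hAv]
      simp only [Matrix.mul_assoc, Matrix.mul_nonsing_inv_cancel_left _ _ hG, pow_two]
  obtain ⟨⟨G₁, hG₁, hq₁, hp₁⟩, G₂, hG₂, hq₂, hp₂⟩ := exists_conj_corner_entries hu hsq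
  obtain ⟨v₁, hv₁, hqv₁, hpv₁⟩ := hreal G₁ hG₁
  obtain ⟨v₂, hv₂, hqv₂, hpv₂⟩ := hreal G₂ hG₂
  have : (A v₁ * A v₁) (Fin.last n) 0 * A v₂ (Fin.last n) 0 =
      A v₁ (Fin.last n) 0 * (A v₂ * A v₂) (Fin.last n) 0 :=
    mul_eq_mul_of_mem_closure continuous_slCoords (hA.mul hA (Fin.last n) 0)
      (hA (Fin.last n) 0) horbit v₁ (hdense hv₁) v₂ (hdense hv₂)
  rw [hqv₁, hpv₁, hqv₂, hpv₂, hq₁, hp₁, hq₂, hp₂] at this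
  simp at this

end NonSpherical

section SquareZero

variable {K : Type*} [Field K]

/-- The normal form of an endomorphism of square zero. -/
theorem exists_basis_of_sq_zero {V : Type*} [AddCommGroup V] [Module K V] [FiniteDimensional K V]
    {f : Module.End K V} (hf : f * f = 0) {i m : ℕ}
    (hi : Module.finrank K (LinearMap.range f) = i)
    (hm : Module.finrank K V = i + (m + i)) :
    ∃ b : Module.Basis (Fin i ⊕ (Fin m ⊕ Fin i)) K V,
      (∀ a, f (b (Sum.inl a)) = b (Sum.inr (Sum.inr a))) ∧ ∀ a, f (b (Sum.inr a)) = 0 := by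
  have hle : LinearMap.range f ≤ LinearMap.ker f := by
    rintro _ ⟨x, rfl⟩
    exact congrArg (fun g : Module.End K V => g x) hf
  obtain ⟨Q, hdisj, hsup⟩ : ∃ Q : Submodule K V, Disjoint (LinearMap.range f) Q ∧
      LinearMap.range f ⊔ Q = LinearMap.ker f := by
    obtain ⟨Q, hQ⟩ := Submodule.exists_isCompl (LinearMap.range f)
    refine ⟨Q ⊓ LinearMap.ker f, hQ.disjoint.mono_right inf_le_left, ?_⟩
    rw [← sup_inf_assoc_of_le _ hle, hQ.sup_eq_top, top_inf_eq]
  have hQker : Q ≤ LinearMap.ker f := hsup ▸ le_sup_right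
  have hQ : Module.finrank K Q = m := by
    have h1 := Submodule.finrank_sup_add_finrank_inf_eq (LinearMap.range f) Q
    rw [hdisj.eq_bot, finrank_bot, hsup, hi] at h1
    have h2 := f.finrank_range_add_finrank_ker
    omega
  obtain ⟨c⟩ : Nonempty (Module.Basis (Fin i) K (LinearMap.range f)) :=
    ⟨Module.finBasisOfFinrankEq K _ hi⟩
  obtain ⟨z⟩ : Nonempty (Module.Basis (Fin m) K Q) := ⟨Module.finBasisOfFinrankEq K _ hQ⟩
  have hcf : ∀ a, ∃ w, f w = c a := fun a => (c a).2
  choose w hw using hcf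
  have hc : LinearIndependent K fun a => (c a : V) :=
    c.linearIndependent.map' (LinearMap.range f).subtype (Submodule.ker_subtype _)
  have hz : LinearIndependent K fun a => (z a : V) :=
    z.linearIndependent.map' Q.subtype (Submodule.ker_subtype _)
  have hfw : LinearIndependent K (f ∘ w) := by
    rwa [show f ∘ w = fun a => (c a : V) from funext hw]
  have hcspan : Submodule.span K (Set.range fun a => (c a : V)) ≤ LinearMap.range f := by
    rw [Submodule.span_le]
    rintro _ ⟨a, rfl⟩
    exact (c a).2
  have hzspan : Submodule.span K (Set.range fun a => (z a : V)) ≤ Q := by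
    rw [Submodule.span_le]
    rintro _ ⟨a, rfl⟩
    exact (z a).2
  have hzc := hz.sum_type hc (hdisj.symm.mono hzspan hcspan)
  have hker : Submodule.span K (Set.range (Sum.elim (fun a => (z a : V)) fun a => (c a : V))) ≤
      LinearMap.ker f := by
    rw [Submodule.span_le]
    rintro _ ⟨a | a, rfl⟩
    · exact hQker (z a).2
    · exact hle (c a).2
  have hall := (hfw.of_comp f).sum_type hzc
    ((Submodule.range_ker_disjoint hfw).mono_right hker)
  refine ⟨Module.Basis.mk hall
    (hall.span_eq_top_of_card_eq_finrank' (by simp [hm])).ge, fun a => ?_, fun a => ?_⟩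
  · rw [Module.Basis.mk_apply, Module.Basis.mk_apply]
    exact hw a
  · rw [Module.Basis.mk_apply]
    exact hker (Submodule.subset_span ⟨a, rfl⟩)

/-- Square-zero matrices of the same rank are conjugate. -/
theorem exists_conj_of_sq_zero {N : ℕ} {M M' : Matrix (Fin N) (Fin N) K} (hM : M ^ 2 = 0)
    (hM' : M' ^ 2 = 0) (hr : M.rank = M'.rank) :
    ∃ g : Matrix (Fin N) (Fin N) K, IsUnit g.det ∧ g * M = M' * g := by
  have hsq : ∀ {A : Matrix (Fin N) (Fin N) K}, A ^ 2 = 0 →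
      Matrix.toLin' A * Matrix.toLin' A = 0 := by
    intro A hA
    rw [Module.End.mul_eq_comp, ← Matrix.toLin'_mul, ← pow_two, hA, map_zero]
  have hrank : ∀ A : Matrix (Fin N) (Fin N) K,
      Module.finrank K (LinearMap.range (Matrix.toLin' A)) = A.rank := fun A => rfl
  have h2 : 2 * M.rank ≤ N := by
    have h1 := (Matrix.toLin' M).finrank_range_add_finrank_ker
    have h3 : LinearMap.range (Matrix.toLin' M) ≤ LinearMap.ker (Matrix.toLin' M) := by
      rintro _ ⟨x, rfl⟩
      exact congrArg (fun g : Module.End K (Fin N → K) => g x) (hsq hM)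
    have h4 := Submodule.finrank_mono h3
    rw [hrank, Module.finrank_fin_fun] at h1
    rw [hrank] at h4
    omega
  have hN : Module.finrank K (Fin N → K) = M.rank + ((N - 2 * M.rank) + M.rank) := by
    rw [Module.finrank_fin_fun]
    omega
  obtain ⟨b, hb, hb0⟩ := exists_basis_of_sq_zero (hsq hM) (hrank M) hN
  obtain ⟨b', hb', hb0'⟩ := exists_basis_of_sq_zero (hsq hM') ((hrank M').trans hr.symm) hN
  let e := b.equiv b' (Equiv.refl _)
  have he : ∀ j, e (b j) = b' j := fun j => by simp [e]
  refine ⟨LinearMap.toMatrix' (e : (Fin N → K) →ₗ[K] Fin N → K), ?_, ?_⟩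
  · rw [LinearMap.det_toMatrix']
    exact e.isUnit_det'
  · apply Matrix.toLin'.injective
    rw [Matrix.toLin'_mul, Matrix.toLin'_mul, Matrix.toLin'_toMatrix']
    refine b.ext fun j => ?_
    simp only [LinearMap.comp_apply, LinearEquiv.coe_coe, he]
    rcases j with j | j
    · rw [hb, hb', he]
    · rw [hb0, hb0', map_zero]

theorem two_mul_rank_le_of_sq_zero {N : ℕ} {M : Matrix (Fin N) (Fin N) K} (hM : M ^ 2 = 0) :
    2 * M.rank ≤ N := by
  have := Matrix.rank_add_rank_le_card_of_mul_eq_zero (A := M) (B := M) (by rw [← pow_two, hM])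
  simp at this
  omega

theorem isConj_of_mem_slX [IsAlgClosed K] {n i : ℕ}
    {u v : Matrix.SpecialLinearGroup (Fin (n + 1)) K} (hu : u ∈ slX K n i) (hv : v ∈ slX K n i) :
    IsConj u v := by
  obtain ⟨g, hg, hgu⟩ := exists_conj_of_sq_zero hu.1 hv.1 (hu.2.trans hv.2.symm)
  refine isConj_of_mul_eq_mul hg ?_
  rw [mul_sub, sub_mul, mul_one, one_mul, sub_left_inj] at hgu
  exact hgu

theorem conj_mem_slX {n i : ℕ} {u : Matrix.SpecialLinearGroup (Fin (n + 1)) K}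
    (hu : u ∈ slX K n i) (g : Matrix.SpecialLinearGroup (Fin (n + 1)) K) :
    g * u * g⁻¹ ∈ slX K n i := by
  have hgg : (g⁻¹).1 * g.1 = 1 := congrArg Subtype.val (inv_mul_cancel g)
  have hgg' : g.1 * (g⁻¹).1 = 1 := congrArg Subtype.val (mul_inv_cancel g)
  have h : (g * u * g⁻¹).1 - 1 = g.1 * (u.1 - 1) * (g⁻¹).1 := by
    rw [mul_sub, sub_mul, mul_one, hgg']
    rfl
  constructor
  · rw [h, pow_two, show g.1 * (u.1 - 1) * (g⁻¹).1 * (g.1 * (u.1 - 1) * (g⁻¹).1) =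
      g.1 * ((u.1 - 1) * ((g⁻¹).1 * g.1) * (u.1 - 1)) * (g⁻¹).1 by simp only [Matrix.mul_assoc],
      hgg, mul_one, ← pow_two, hu.1, mul_zero, zero_mul]
  · rw [h, Matrix.rank_mul_eq_left_of_isUnit_det _ _ (by rw [(g⁻¹).2]; exact isUnit_one),
      Matrix.rank_mul_eq_right_of_isUnit_det _ _ (by rw [g.2]; exact isUnit_one)]
    exact hu.2

theorem conjClass_eq_slX [IsAlgClosed K] {n i : ℕ}
    {u : Matrix.SpecialLinearGroup (Fin (n + 1)) K} (hu : u ∈ slX K n i) :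
    conjClass u = slX K n i := by
  ext v
  refine ⟨fun hv => ?_, fun hv => isConj_of_mem_slX hu hv⟩
  obtain ⟨g, rfl⟩ := isConj_iff.1 hv
  exact conj_mem_slX hu g

end SquareZero

section Chart

variable {K ι μ : Type*} [Field K] [Fintype ι] [Fintype μ] [DecidableEq ι]

/-- The matrix of square zero of rank `card ι` with lower left corner `A`, where `A` is invertible,
whose column space is spanned by `(Yi, Ym, 1)` and whose row space is spanned by
`(1, Zm, -(Yi + Zm * Ym))`. -/
def chartMatrix (A Yi : Matrix ι ι K) (Ym : Matrix μ ι K) (Zm : Matrix ι μ K) :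
    Matrix (ι ⊕ μ ⊕ ι) (ι ⊕ μ ⊕ ι) K :=
  Matrix.fromRows Yi (Matrix.fromRows Ym 1) * A *
    Matrix.fromCols 1 (Matrix.fromCols Zm (-(Yi + Zm * Ym)))

theorem fromCols_mul_fromRows_eq_zero (Yi : Matrix ι ι K) (Ym : Matrix μ ι K)
    (Zm : Matrix ι μ K) :
    Matrix.fromCols (1 : Matrix ι ι K) (Matrix.fromCols Zm (-(Yi + Zm * Ym))) *
      Matrix.fromRows Yi (Matrix.fromRows Ym (1 : Matrix ι ι K)) = 0 := by
  rw [Matrix.fromCols_mul_fromRows, Matrix.fromCols_mul_fromRows, Matrix.one_mul, Matrix.mul_one]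
  abel

theorem chartMatrix_sq [DecidableEq μ] (A Yi : Matrix ι ι K) (Ym : Matrix μ ι K)
    (Zm : Matrix ι μ K) :
    chartMatrix A Yi Ym Zm ^ 2 = 0 := by
  have h : ∀ {C : Matrix (ι ⊕ μ ⊕ ι) ι K} {R : Matrix ι (ι ⊕ μ ⊕ ι) K}, R * C = 0 →
      (C * A * R) ^ 2 = 0 := fun {C R} hRC => by
    rw [pow_two, Matrix.mul_assoc, ← Matrix.mul_assoc R, ← Matrix.mul_assoc R, hRC,
      Matrix.zero_mul, Matrix.zero_mul, Matrix.mul_zero]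
  exact h (fromCols_mul_fromRows_eq_zero Yi Ym Zm)

theorem chartMatrix_submatrix (A Yi : Matrix ι ι K) (Ym : Matrix μ ι K) (Zm : Matrix ι μ K) :
    (chartMatrix A Yi Ym Zm).submatrix (Sum.inr ∘ Sum.inr) Sum.inl = A := by
  rw [chartMatrix, Matrix.mul_fromCols, Matrix.mul_one, Matrix.fromRows_mul, Matrix.fromRows_mul,
    Matrix.one_mul]
  ext a b
  rfl

theorem det_one_add_chartMatrix [DecidableEq μ] (A Yi : Matrix ι ι K) (Ym : Matrix μ ι K)
    (Zm : Matrix ι μ K) :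
    (1 + chartMatrix A Yi Ym Zm).det = 1 := by
  rw [chartMatrix, Matrix.mul_assoc, Matrix.det_one_add_mul_comm, Matrix.mul_assoc,
    fromCols_mul_fromRows_eq_zero, Matrix.mul_zero, add_zero, Matrix.det_one]

theorem rank_chartMatrix {A Yi : Matrix ι ι K} (hA : IsUnit A.det) (Ym : Matrix μ ι K)
    (Zm : Matrix ι μ K) : (chartMatrix A Yi Ym Zm).rank = Fintype.card ι := by
  apply le_antisymm
  · exact (Matrix.rank_mul_le_right _ _).trans (Matrix.rank_le_card_height _)
  · rw [← Matrix.rank_of_isUnit A ((Matrix.isUnit_iff_isUnit_det A).2 hA)]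
    conv_lhs => rw [← chartMatrix_submatrix A Yi Ym Zm]
    exact Matrix.rank_submatrix_le _ _ _

/-- A matrix of rank `r` is determined by the rows and the columns of an invertible minor of
size `r`. -/
theorem eq_mul_inv_mul_of_rank_eq {α β : Type*} [Fintype α] [Fintype β] {M : Matrix α β K}
    (r : ι → α) (c : ι → β) (hr : M.rank = Fintype.card ι)
    (hA : IsUnit (M.submatrix r c).det) :
    M = M.submatrix id c * (M.submatrix r c)⁻¹ * M.submatrix r id := by
  have h1 : LinearMap.range (M.submatrix id c).mulVecLin ≤ LinearMap.range M.mulVecLin := by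
    have : M.submatrix id c = M * (1 : Matrix β β K).submatrix id c := by
      exact (Matrix.mul_submatrix_one (Equiv.refl β) c M).symm
    rw [this, Matrix.mulVecLin_mul]
    exact LinearMap.range_comp_le_range _ _
  have h2 : LinearMap.range (M.submatrix id c).mulVecLin = LinearMap.range M.mulVecLin := by
    refine Submodule.eq_of_le_of_finrank_le h1 ?_
    change M.rank ≤ (M.submatrix id c).rank
    rw [hr, ← Matrix.rank_of_isUnit _ ((Matrix.isUnit_iff_isUnit_det _).2 hA)]
    exact Matrix.rank_submatrix_le (M.submatrix id c) r id
  have h3 : ∀ j, ∃ x, (M.submatrix id c) *ᵥ x = M.col j := fun j => by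
    have : M.col j ∈ LinearMap.range M.mulVecLin :=
      ⟨Pi.single j 1, by rw [Matrix.mulVecLin_apply, Matrix.mulVec_single_one]⟩
    rw [← h2] at this
    exact this
  choose x hx using h3
  have h4 : M = M.submatrix id c * Matrix.of fun a j => x j a := by
    ext a j
    exact (congrFun (hx j) a).symm
  have h5 : M.submatrix r id = M.submatrix r c * Matrix.of fun a j => x j a := by
    conv_lhs => rw [h4]
    rfl
  rw [h5, Matrix.mul_assoc, Matrix.nonsing_inv_mul_cancel_left _ _ hA]
  exact h4

theorem eq_chartMatrix [DecidableEq μ] {M : Matrix (ι ⊕ μ ⊕ ι) (ι ⊕ μ ⊕ ι) K} (hM : M ^ 2 = 0)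
    (hr : M.rank = Fintype.card ι)
    (hA : IsUnit (M.submatrix (Sum.inr ∘ Sum.inr) Sum.inl : Matrix ι ι K).det) :
    M = chartMatrix (M.submatrix (Sum.inr ∘ Sum.inr) Sum.inl)
      (M.submatrix Sum.inl Sum.inl * (M.submatrix (Sum.inr ∘ Sum.inr) Sum.inl)⁻¹)
      (M.submatrix (Sum.inr ∘ Sum.inl) Sum.inl * (M.submatrix (Sum.inr ∘ Sum.inr) Sum.inl)⁻¹)
      ((M.submatrix (Sum.inr ∘ Sum.inr) Sum.inl)⁻¹ *
        M.submatrix (Sum.inr ∘ Sum.inr) (Sum.inr ∘ Sum.inl)) := by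
  have h1 := eq_mul_inv_mul_of_rank_eq (Sum.inr ∘ Sum.inr) Sum.inl hr hA
  generalize hA' : (M.submatrix (Sum.inr ∘ Sum.inr) Sum.inl : Matrix ι ι K) = A at *
  have hC : M.submatrix id Sum.inl * A⁻¹ = Matrix.fromRows (M.submatrix Sum.inl Sum.inl * A⁻¹)
      (Matrix.fromRows (M.submatrix (Sum.inr ∘ Sum.inl) Sum.inl * A⁻¹) 1) := by
    have h : (M.submatrix (Sum.inr ∘ Sum.inr) Sum.inl : Matrix ι ι K) * A⁻¹ = 1 := by
      rw [hA', Matrix.mul_nonsing_inv A hA]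
    ext (a | a | a) b
    · rfl
    · rfl
    · exact congrFun (congrFun h a) b
  have hR : A⁻¹ * M.submatrix (Sum.inr ∘ Sum.inr) id = Matrix.fromCols 1
      (Matrix.fromCols (A⁻¹ * M.submatrix (Sum.inr ∘ Sum.inr) (Sum.inr ∘ Sum.inl))
        (A⁻¹ * M.submatrix (Sum.inr ∘ Sum.inr) (Sum.inr ∘ Sum.inr))) := by
    have h : A⁻¹ * (M.submatrix (Sum.inr ∘ Sum.inr) Sum.inl : Matrix ι ι K) = 1 := by
      rw [hA', Matrix.nonsing_inv_mul A hA]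
    ext a (b | b | b)
    · exact congrFun (congrFun h a) b
    · rfl
    · rfl
  have hRC : (A⁻¹ * M.submatrix (Sum.inr ∘ Sum.inr) id) * (M.submatrix id Sum.inl * A⁻¹) = 0 := by
    have h : (M.submatrix (Sum.inr ∘ Sum.inr) id : Matrix ι _ K) *
        (M.submatrix id Sum.inl : Matrix _ ι K) = 0 := by
      change (M * M).submatrix _ _ = 0
      rw [← pow_two, hM]
      rfl
    rw [Matrix.mul_assoc, ← Matrix.mul_assoc (M.submatrix _ _), h, Matrix.zero_mul,
      Matrix.mul_zero]
  rw [chartMatrix, ← hC]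
  rw [hC, hR, Matrix.fromCols_mul_fromRows, Matrix.fromCols_mul_fromRows, Matrix.one_mul,
    Matrix.mul_one, ← add_assoc] at hRC
  rw [← eq_neg_of_add_eq_zero_right hRC, ← hR, Matrix.nonsing_inv_mul_cancel_right _ _ hA,
    ← Matrix.mul_assoc]
  exact h1

/-- A block upper triangular matrix conjugating `chartMatrix J 0 0 0` to `chartMatrix A Yi Ym Zm`
when `A * p = b * J`. -/
def chartConj (p b Yi : Matrix ι ι K) (Ym : Matrix μ ι K) (Zm : Matrix ι μ K) [DecidableEq μ] :
    Matrix (ι ⊕ μ ⊕ ι) (ι ⊕ μ ⊕ ι) K :=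
  Matrix.fromBlocks p (Matrix.fromCols (-Zm) (Yi * b)) 0 (Matrix.fromBlocks 1 (Ym * b) 0 b)

theorem det_chartConj [DecidableEq μ] (p b Yi : Matrix ι ι K) (Ym : Matrix μ ι K)
    (Zm : Matrix ι μ K) : (chartConj p b Yi Ym Zm).det = p.det * b.det := by
  rw [chartConj, Matrix.det_fromBlocks_zero₂₁, Matrix.det_fromBlocks_zero₂₁, Matrix.det_one,
    one_mul]

theorem chartMatrix_mul_chartConj [DecidableEq μ] {A J p b : Matrix ι ι K} (h : A * p = b * J)
    (Yi : Matrix ι ι K) (Ym : Matrix μ ι K) (Zm : Matrix ι μ K) :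
    chartMatrix A Yi Ym Zm * chartConj p b Yi Ym Zm =
      chartConj p b Yi Ym Zm * chartMatrix J 0 0 0 := by
  have hR : Matrix.fromCols (1 : Matrix ι ι K) (Matrix.fromCols Zm (-(Yi + Zm * Ym))) *
      chartConj p b Yi Ym Zm = p * Matrix.fromCols (1 : Matrix ι ι K)
        (Matrix.fromCols (0 : Matrix ι μ K) (0 : Matrix ι ι K)) := by
    rw [chartConj, Matrix.fromCols_mul_fromBlocks, Matrix.fromCols_mul_fromBlocks,
      Matrix.mul_fromCols, Matrix.mul_fromCols]
    simp only [Matrix.one_mul, Matrix.mul_zero, Matrix.mul_one, add_zero]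
    congr 1
    ext a (c | c)
    · simp
    · simp [Matrix.add_mul, Matrix.mul_assoc]
  have hC : chartConj p b Yi Ym Zm * Matrix.fromRows (0 : Matrix ι ι K)
        (Matrix.fromRows (0 : Matrix μ ι K) (1 : Matrix ι ι K)) =
      Matrix.fromRows Yi (Matrix.fromRows Ym (1 : Matrix ι ι K)) * b := by
    rw [chartConj, Matrix.fromBlocks_mul_fromRows, Matrix.fromBlocks_mul_fromRows,
      Matrix.fromRows_mul, Matrix.fromRows_mul, Matrix.fromCols_mul_fromRows]
    simp
  rw [chartMatrix, Matrix.mul_assoc, hR, chartMatrix, zero_add, Matrix.mul_zero, neg_zero,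
    ← Matrix.mul_assoc, ← Matrix.mul_assoc (chartConj p b Yi Ym Zm),
    ← Matrix.mul_assoc (chartConj p b Yi Ym Zm), hC,
    Matrix.mul_assoc _ A,
    h, Matrix.mul_assoc _ b]

end Chart

section LU

variable {K : Type*} [Field K]

/-- A matrix with nonzero leading principal minors has an LU decomposition. -/
theorem exists_upper_mul_lower {r : ℕ} (A : Matrix (Fin r) (Fin r) K)
    (hA : ∀ s (h : s ≤ r), (A.submatrix (Fin.castLE h) (Fin.castLE h)).det ≠ 0) :
    ∃ U : Matrix (Fin r) (Fin r) K, IsUnit U.det ∧ (∀ a b, b < a → U a b = 0) ∧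
      ∀ a b, a < b → (A * U) a b = 0 := by
  induction r with
  | zero => exact ⟨1, by simp, fun a => a.elim0, fun a => a.elim0⟩
  | succ r ih =>
    obtain ⟨U, hU, hU1, hU2⟩ := ih (A.submatrix Fin.castSucc Fin.castSucc) fun s h =>
      hA s (h.trans r.le_succ)
    have hA1 : IsUnit (A.submatrix Fin.castSucc Fin.castSucc).det := (hA r r.le_succ).isUnit
    let e : Fin r ⊕ Fin 1 ≃ Fin (r + 1) := finSumFinEquiv
    let A12 : Matrix (Fin r) (Fin 1) K := A.submatrix Fin.castSucc (Fin.natAdd r)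
    let A21 : Matrix (Fin 1) (Fin r) K := A.submatrix (Fin.natAdd r) Fin.castSucc
    let A22 : Matrix (Fin 1) (Fin 1) K := A.submatrix (Fin.natAdd r) (Fin.natAdd r)
    let V : Matrix (Fin r ⊕ Fin 1) (Fin r ⊕ Fin 1) K :=
      Matrix.fromBlocks U (-((A.submatrix Fin.castSucc Fin.castSucc)⁻¹ * A12)) 0 1
    have hAe : A.submatrix e e =
        Matrix.fromBlocks (A.submatrix Fin.castSucc Fin.castSucc) A12 A21 A22 := by
      ext (a | a) (b | b) <;> rfl
    have hmul : A * V.submatrix e.symm e.symm = (A.submatrix e e * V).submatrix e.symm e.symm := by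
      rw [← Matrix.submatrix_mul_equiv _ _ _ e.symm]
      simp
    refine ⟨V.submatrix e.symm e.symm, ?_, ?_, ?_⟩
    · rw [Matrix.det_submatrix_equiv_self, Matrix.det_fromBlocks_zero₂₁, Matrix.det_one, mul_one]
      exact hU
    · rw [e.surjective.forall₂]
      rintro (a | a) (b | b) hab
      · simpa [V] using hU1 a b hab
      · have := a.isLt
        simp [e, Fin.lt_def] at hab
        omega
      · simp [V]
      · exact absurd hab (by simp [Subsingleton.elim a b])
    · rw [hmul, hAe, Matrix.fromBlocks_multiply, e.surjective.forall₂]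
      rintro (a | a) (b | b) hab
      · simpa using hU2 a b hab
      · simp [← Matrix.mul_assoc, Matrix.mul_nonsing_inv _ hA1]
      · have := b.isLt
        simp [e, Fin.lt_def] at hab
        omega
      · exact absurd hab (by simp [Subsingleton.elim a b])

/-- If all lower left corner minors of `A` are nonzero, then `A` factors through the reversal
matrix and upper triangular matrices. -/
theorem exists_upper_mul_eq_upper_mul_rev {r : ℕ} (A : Matrix (Fin r) (Fin r) K)
    (hA : ∀ s (h : s ≤ r), (A.submatrix (Fin.rev ∘ Fin.castLE h) (Fin.castLE h)).det ≠ 0) :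
    ∃ p b : Matrix (Fin r) (Fin r) K, IsUnit p.det ∧ IsUnit b.det ∧ (∀ a c, c < a → p a c = 0) ∧
      (∀ a c, c < a → b a c = 0) ∧
      A * p = b * (1 : Matrix (Fin r) (Fin r) K).submatrix Fin.rev id := by
  obtain ⟨U, hU, hU1, hU2⟩ := exists_upper_mul_lower (A.submatrix Fin.rev id) hA
  have hmul : A.submatrix Fin.rev id * U = (A * U).submatrix Fin.rev id := rfl
  have hb : A * U = (A * U).submatrix id Fin.rev *
      (1 : Matrix (Fin r) (Fin r) K).submatrix Fin.rev id := by
    have := Matrix.mul_submatrix_one Fin.revPerm id ((A * U).submatrix id Fin.rev)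
    refine Eq.trans ?_ this.symm
    ext a c
    simp
  have hdet : IsUnit (A.submatrix Fin.rev id).det := by
    have := (hA r le_rfl).isUnit
    exact this
  refine ⟨U, (A * U).submatrix id Fin.rev, hU, ?_, hU1, fun a c hac => ?_, hb⟩
  · have h2 : ((A * U).submatrix id Fin.rev).det = _ :=
      (Matrix.det_submatrix_equiv_self Fin.revPerm ((A * U).submatrix id Fin.rev)).symm
    have h3 : ((A * U).submatrix id Fin.rev).submatrix Fin.revPerm Fin.revPerm =
        A.submatrix Fin.rev id * U := by
      rw [hmul]
      ext a c
      simp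
    rw [h2, h3, Matrix.det_mul]
    exact hdet.mul hU
  · have := hU2 a.rev c.rev (Fin.rev_lt_rev.2 hac)
    rw [hmul] at this
    simpa using this

end LU

section Spherical

attribute [local instance] zariskiTopology

variable {K : Type*} [Field K] {n i m : ℕ}

theorem isIrreducible_conjClass [IsAlgClosed K]
    (u : Matrix.SpecialLinearGroup (Fin (n + 1)) K) : IsIrreducible (conjClass u) := by
  let mat : (Fin (n + 1) × Fin (n + 1) → K) → Matrix (Fin (n + 1)) (Fin (n + 1)) K := fun v =>
    Matrix.of fun i j => v (i, j)
  have hreg : IsRegularMatrix id mat := fun i j => coord_mem_regularFunctions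
    (id : (Fin (n + 1) × Fin (n + 1) → K) → _) (i, j)
  let Y := {v | (mat v).det ≠ 0}
  have hY : IsIrreducible Y := isIrreducible_ne_zero_of_regular hreg.det
    ⟨slCoords (1 : Matrix.SpecialLinearGroup (Fin (n + 1)) K), by
      have : mat (slCoords (1 : Matrix.SpecialLinearGroup (Fin (n + 1)) K)) = 1 := rfl
      rw [this]
      simp⟩
  have hdet : ∀ v : Y, IsUnit (mat v).det := fun v => isUnit_iff_ne_zero.2 v.2
  let φ : Y → Matrix.SpecialLinearGroup (Fin (n + 1)) K := fun v =>
    ⟨mat v * u.1 * (mat v)⁻¹, by rw [Matrix.det_conj ((Matrix.isUnit_iff_isUnit_det _).2 (hdet v)),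
      u.2]⟩
  have hregY : IsRegularMatrix (fun v : Y => (v : Fin (n + 1) × Fin (n + 1) → K))
      fun v : Y => mat v := fun i j => coord_mem_regularFunctions
    (fun v : Y => (v : Fin (n + 1) × Fin (n + 1) → K)) (i, j)
  have hφ : Continuous φ :=
    continuous_sl_of_regular (e := fun v : Y => (v : Fin (n + 1) × Fin (n + 1) → K))
      continuous_subtype_val
      ((hregY.mul (IsRegularMatrix.const u.1)).mul (hregY.inv fun v => v.2))
  have himg : φ '' Set.univ = conjClass u := by
    ext g
    constructor
    · rintro ⟨v, -, rfl⟩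
      refine isConj_of_mul_eq_mul (hdet v) ?_
      exact (Matrix.nonsing_inv_mul_cancel_right _ _ (hdet v)).symm
    · intro hg
      obtain ⟨h, rfl⟩ := isConj_iff.1 hg
      have hh : mat (slCoords h) = h.1 := rfl
      refine ⟨⟨slCoords h, by simp [Y, hh]⟩, trivial, Subtype.ext ?_⟩
      change h.1 * u.1 * (h.1)⁻¹ = h.1 * u.1 * (h⁻¹).1
      rw [Matrix.inv_eq_right_inv (congrArg Subtype.val (mul_inv_cancel h))]
  rw [← himg]
  have : IrreducibleSpace Y := isIrreducible_iff_irreducibleSpace.1 hY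
  exact (IrreducibleSpace.isIrreducible_univ Y).image φ hφ.continuousOn

/-- The order preserving identification of `i + m + i` block indices with `Fin (n + 1)`. -/
def blockEquiv (h : i + (m + i) = n + 1) : Fin i ⊕ Fin m ⊕ Fin i ≃ Fin (n + 1) :=
  ((Equiv.sumCongr (Equiv.refl _) finSumFinEquiv).trans finSumFinEquiv).trans (finCongr h)

/-- The matrix `g - 1`, in block form. -/
def slBlock (h : i + (m + i) = n + 1) (g : Matrix.SpecialLinearGroup (Fin (n + 1)) K) :
    Matrix (Fin i ⊕ Fin m ⊕ Fin i) (Fin i ⊕ Fin m ⊕ Fin i) K :=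
  (g.1 - 1).submatrix (blockEquiv h) (blockEquiv h)

theorem mem_slX_iff_slBlock (h : i + (m + i) = n + 1)
    {g : Matrix.SpecialLinearGroup (Fin (n + 1)) K} {r : ℕ} :
    g ∈ slX K n r ↔ slBlock h g ^ 2 = 0 ∧ (slBlock h g).rank = r := by
  rw [slBlock, Matrix.rank_submatrix, pow_two, Matrix.submatrix_mul_equiv, ← pow_two]
  refine and_congr_left fun _ => ⟨fun h0 => ?_, fun h0 => ?_⟩
  · rw [h0]
    rfl
  · have := congrArg (fun A => A.submatrix (blockEquiv h).symm (blockEquiv h).symm) h0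
    simpa using! this

/-- The element of the special linear group with a given chart matrix. -/
def chartSL (h : i + (m + i) = n + 1) (A Yi : Matrix (Fin i) (Fin i) K)
    (Ym : Matrix (Fin m) (Fin i) K) (Zm : Matrix (Fin i) (Fin m) K) :
    Matrix.SpecialLinearGroup (Fin (n + 1)) K :=
  ⟨(1 + chartMatrix A Yi Ym Zm).submatrix (blockEquiv h).symm (blockEquiv h).symm, by
    rw [Matrix.det_submatrix_equiv_self, det_one_add_chartMatrix]⟩

theorem slBlock_chartSL (h : i + (m + i) = n + 1) (A Yi : Matrix (Fin i) (Fin i) K)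
    (Ym : Matrix (Fin m) (Fin i) K) (Zm : Matrix (Fin i) (Fin m) K) :
    slBlock h (chartSL h A Yi Ym Zm) = chartMatrix A Yi Ym Zm := by
  have : (chartSL h A Yi Ym Zm).1 - 1 =
      (chartMatrix A Yi Ym Zm).submatrix (blockEquiv h).symm (blockEquiv h).symm := by
    refine sub_eq_iff_eq_add'.2 ?_
    rw [← Matrix.submatrix_one_equiv (blockEquiv h).symm]
    rfl
  rw [slBlock, this, Matrix.submatrix_submatrix, Equiv.symm_comp_self, Matrix.submatrix_id_id]

theorem slBlock_injective (h : i + (m + i) = n + 1) :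
    Function.Injective (slBlock (K := K) h) := by
  intro g g' hgg'
  have := congrArg (fun A => A.submatrix (blockEquiv h).symm (blockEquiv h).symm) hgg'
  refine Subtype.ext ?_
  simpa [slBlock, Matrix.submatrix_submatrix] using this

theorem chartSL_mem_slX (h : i + (m + i) = n + 1) {A : Matrix (Fin i) (Fin i) K}
    (hA : IsUnit A.det) (Yi : Matrix (Fin i) (Fin i) K)
    (Ym : Matrix (Fin m) (Fin i) K) (Zm : Matrix (Fin i) (Fin m) K) :
    chartSL h A Yi Ym Zm ∈ slX K n i := by
  rw [mem_slX_iff_slBlock h, slBlock_chartSL, rank_chartMatrix hA, Fintype.card_fin]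
  exact ⟨chartMatrix_sq _ _ _ _, rfl⟩

/-- The lower left corner of `g - 1`. -/
def slCorner (h : i + (m + i) = n + 1) (g : Matrix.SpecialLinearGroup (Fin (n + 1)) K) :
    Matrix (Fin i) (Fin i) K :=
  (slBlock h g).submatrix (Sum.inr ∘ Sum.inr) Sum.inl

theorem slCorner_chartSL (h : i + (m + i) = n + 1) (A Yi : Matrix (Fin i) (Fin i) K)
    (Ym : Matrix (Fin m) (Fin i) K) (Zm : Matrix (Fin i) (Fin m) K) :
    slCorner h (chartSL h A Yi Ym Zm) = A := by
  rw [slCorner, slBlock_chartSL, chartMatrix_submatrix]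

theorem exists_eq_chartSL (h : i + (m + i) = n + 1)
    {g : Matrix.SpecialLinearGroup (Fin (n + 1)) K} (hg : g ∈ slX K n i)
    (hA : IsUnit (slCorner h g).det) :
    g = chartSL h (slCorner h g)
      ((slBlock h g).submatrix Sum.inl Sum.inl * (slCorner h g)⁻¹)
      ((slBlock h g).submatrix (Sum.inr ∘ Sum.inl) Sum.inl * (slCorner h g)⁻¹)
      ((slCorner h g)⁻¹ * (slBlock h g).submatrix (Sum.inr ∘ Sum.inr) (Sum.inr ∘ Sum.inl)) := by
  rw [mem_slX_iff_slBlock h] at hg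
  apply slBlock_injective h
  rw [slBlock_chartSL]
  exact eq_chartMatrix hg.1 (hg.2.trans (Fintype.card_fin i).symm) hA

theorem isRegularMatrix_slBlock (h : i + (m + i) = n + 1) :
    IsRegularMatrix (slCoords (K := K)) (slBlock h) :=
  ((isRegularMatrix_coe_sl id).sub (IsRegularMatrix.const 1)).submatrix _ _

theorem isRegularMatrix_slCorner (h : i + (m + i) = n + 1) :
    IsRegularMatrix (slCoords (K := K)) (slCorner h) :=
  (isRegularMatrix_slBlock h).submatrix _ _

theorem chartConj_blockTriangular (h : i + (m + i) = n + 1) {p b : Matrix (Fin i) (Fin i) K}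
    (hp : ∀ a c, c < a → p a c = 0) (hb : ∀ a c, c < a → b a c = 0)
    (Yi : Matrix (Fin i) (Fin i) K)
    (Ym : Matrix (Fin m) (Fin i) K) (Zm : Matrix (Fin i) (Fin m) K) :
    ((chartConj p b Yi Ym Zm).submatrix (blockEquiv h).symm
      (blockEquiv h).symm).BlockTriangular id := by
  unfold Matrix.BlockTriangular
  rw [(blockEquiv h).surjective.forall₂]
  rintro (x | x | x) (y | y | y) hxy <;>
    simp only [id, blockEquiv, Fin.lt_def, Equiv.trans_apply, Equiv.sumCongr_apply, Sum.map_inl,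
      Sum.map_inr, Equiv.refl_apply, finSumFinEquiv_apply_left, finSumFinEquiv_apply_right,
      finCongr_apply, Fin.val_cast, Fin.val_castAdd, Fin.val_natAdd] at hxy <;>
    simp only [Matrix.submatrix_apply, Equiv.symm_apply_apply]
  · exact hp _ _ (Fin.lt_def.2 hxy)
  · have := x.isLt
    omega
  · have := x.isLt
    omega
  · rfl
  · exact Matrix.one_apply_ne fun hh => by
      subst hh
      omega
  · have := x.isLt
    omega
  · rfl
  · rfl
  · exact hb _ _ (Fin.lt_def.2 (by omega))

theorem mem_conjOrbit_chartSL [IsAlgClosed K] (h : i + (m + i) = n + 1)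
    {g : Matrix.SpecialLinearGroup (Fin (n + 1)) K} (hg : g ∈ slX K n i)
    (hA : ∀ s (hs : s ≤ i),
      ((slCorner h g).submatrix (Fin.rev ∘ Fin.castLE hs) (Fin.castLE hs)).det ≠ 0) :
    g ∈ conjOrbit (slBorel K (n + 1))
      (chartSL h ((1 : Matrix (Fin i) (Fin i) K).submatrix Fin.rev id) 0 0 0) := by
  obtain ⟨p, b, hp, hb, hp', hb', hpb⟩ := exists_upper_mul_eq_upper_mul_rev _ hA
  have hu : IsUnit (slCorner h g).det := by
    have h1 : (slCorner h g).submatrix (Fin.rev ∘ Fin.castLE le_rfl) (Fin.castLE le_rfl) =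
      (1 : Matrix (Fin i) (Fin i) K).submatrix Fin.rev id * slCorner h g :=
      (Matrix.one_submatrix_mul Fin.rev (Equiv.refl _) (slCorner h g)).symm
    have h2 := hA i le_rfl
    rw [h1, Matrix.det_mul] at h2
    exact isUnit_iff_ne_zero.2 (right_ne_zero_of_mul h2)
  obtain ⟨A, Yi, Ym, Zm, rfl, hgA⟩ : ∃ A Yi Ym Zm, slCorner h g = A ∧ g = chartSL h A Yi Ym Zm :=
    ⟨_, _, _, _, rfl, exists_eq_chartSL h hg hu⟩
  have hdet : IsUnit ((chartConj p b Yi Ym Zm).submatrix (blockEquiv h).symm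
      (blockEquiv h).symm).det := by
    rw [Matrix.det_submatrix_equiv_self, det_chartConj]
    exact hp.mul hb
  obtain ⟨c, g', hg'⟩ := exists_sl_eq_smul hdet
  refine ⟨g', ?_, eq_conj_of_eq_smul hg' ?_⟩
  · rw [mem_slBorel_iff, hg']
    intro a d had
    rw [Matrix.smul_apply, chartConj_blockTriangular h hp' hb' Yi Ym Zm had, smul_zero]
  · rw [hgA]
    change _ * ((1 + _ : Matrix _ _ K).submatrix _ _) = ((1 + _ : Matrix _ _ K).submatrix _ _) * _
    rw [Matrix.submatrix_mul_equiv, Matrix.submatrix_mul_equiv, mul_add, add_mul, mul_one, one_mul,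
      chartMatrix_mul_chartConj hpb]

theorem isSphericalClass_slX [IsAlgClosed K] (hi : 2 * i ≤ n + 1) :
    IsSphericalClass (Matrix.SpecialLinearGroup (Fin (n + 1)) K) (slX K n i) := by
  obtain ⟨m, h⟩ : ∃ m, i + (m + i) = n + 1 := ⟨n + 1 - 2 * i, by omega⟩
  let J := (1 : Matrix (Fin i) (Fin i) K).submatrix Fin.rev id
  have hJ : ∀ s (hs : s ≤ i), (J.submatrix (Fin.rev ∘ Fin.castLE hs) (Fin.castLE hs)).det = 1 := by
    intro s hs
    rw [show J.submatrix (Fin.rev ∘ Fin.castLE hs) (Fin.castLE hs) = 1 by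
      ext a b
      simp [J, Matrix.one_apply], Matrix.det_one]
  have hJu : IsUnit J.det := by
    have h1 : J.submatrix (Fin.rev ∘ Fin.castLE le_rfl) (Fin.castLE le_rfl) = J * J :=
      (Matrix.one_submatrix_mul Fin.rev (Equiv.refl _) J).symm
    have h2 := hJ i le_rfl
    rw [h1, Matrix.det_mul] at h2
    exact IsUnit.of_mul_eq_one _ h2
  let x := chartSL (n := n) h J 0 0 0
  have hx : x ∈ slX K n i := chartSL_mem_slX h hJu _ _ _
  refine ⟨_, isBorel_slBorel n, x, hx, fun y hy => ?_⟩
  let f : Matrix.SpecialLinearGroup (Fin (n + 1)) K → K := fun g =>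
    ∏ s : Fin (i + 1), ((slCorner h g).submatrix (Fin.rev ∘ Fin.castLE (Nat.le_of_lt_succ s.2))
      (Fin.castLE (Nat.le_of_lt_succ s.2))).det
  have hf : f ∈ regularFunctions slCoords := prod_mem_regularFunctions _ fun s _ =>
    ((isRegularMatrix_slCorner h).submatrix _ _).det
  have hU := isOpen_ne_zero_of_regular continuous_slCoords hf
  have hirr : IsIrreducible (slX K n i) := conjClass_eq_slX hx ▸ isIrreducible_conjClass x
  rw [mem_closure_iff]
  intro o ho hyo
  obtain ⟨g, hg, hgo, hgf⟩ := hirr.2 o _ ho hU ⟨y, hy, hyo⟩ ⟨x, hx, by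
    simp [f, x, slCorner_chartSL, hJ]⟩
  refine ⟨g, hgo, mem_conjOrbit_chartSL h hg fun s hs => ?_⟩
  exact Finset.prod_ne_zero_iff.1 hgf ⟨s, Nat.lt_succ_of_le hs⟩ (Finset.mem_univ _)

end Spherical

section Dimension

attribute [local instance] zariskiTopology

variable {K : Type*} [Field K] {n i m : ℕ}

theorem IsRegularMatrix.comp {ι X Y l p : Type*} {e : X → ι → K} {A : X → Matrix l p K}
    (hA : IsRegularMatrix e A) (ψ : Y → X) :
    IsRegularMatrix (fun y => e (ψ y)) fun y => A (ψ y) := by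
  intro a b
  obtain ⟨p, q, h⟩ := hA a b
  exact ⟨p, q, fun y => h (ψ y)⟩

theorem IsRegularMatrix.fromRows {ι X l l' p : Type*} {e : X → ι → K} {A : X → Matrix l p K}
    {B : X → Matrix l' p K} (hA : IsRegularMatrix e A) (hB : IsRegularMatrix e B) :
    IsRegularMatrix e fun x => Matrix.fromRows (A x) (B x) := by
  rintro (a | a) b
  · exact hA a b
  · exact hB a b

theorem IsRegularMatrix.fromCols {ι X l p p' : Type*} {e : X → ι → K} {A : X → Matrix l p K}
    {B : X → Matrix l p' K} (hA : IsRegularMatrix e A) (hB : IsRegularMatrix e B) :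
    IsRegularMatrix e fun x => Matrix.fromCols (A x) (B x) := by
  rintro a (b | b)
  · exact hA a b
  · exact hB a b

theorem chartMatrix_eq_fromCols {ι μ : Type*} [Fintype ι] [Fintype μ] [DecidableEq ι]
    (A Yi : Matrix ι ι K) (Ym : Matrix μ ι K) (Zm : Matrix ι μ K) :
    chartMatrix A Yi Ym Zm = Matrix.fromCols
      (Matrix.fromRows (Yi * A) (Matrix.fromRows (Ym * A) A))
      (Matrix.fromRows (Yi * A) (Matrix.fromRows (Ym * A) A) *
        Matrix.fromCols Zm (-(Yi + Zm * Ym))) := by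
  rw [chartMatrix, Matrix.mul_fromCols, Matrix.mul_one, Matrix.fromRows_mul, Matrix.fromRows_mul,
    Matrix.one_mul]

/-- The affine coordinates on the chart of `slX K n i` consisting of the elements whose lower left
corner is invertible. -/
abbrev ChartIndex (i m : ℕ) : Type :=
  (Fin i × Fin i) ⊕ (Fin i × Fin i) ⊕ (Fin m × Fin i) ⊕ (Fin i × Fin m)

/-- The lower left corner of the element with given chart coordinates. -/
def chartCorner (v : ChartIndex i m → K) : Matrix (Fin i) (Fin i) K :=
  Matrix.of fun a b => v (Sum.inl (a, b))

theorem isRegularMatrix_chartCorner :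
    IsRegularMatrix (id : (ChartIndex i m → K) → ChartIndex i m → K) chartCorner :=
  fun a b => coord_mem_regularFunctions _ (Sum.inl (a, b))

/-- The open subset of `slX K n i` of the elements with invertible lower left corner is an open
subset of affine space. -/
def chartHomeomorph (h : i + (m + i) = n + 1) :
    {g : slX K n i | (slCorner h g.1).det ≠ 0} ≃ₜ
      {v : ChartIndex i m → K | (chartCorner v).det ≠ 0} where
  toFun g := ⟨Sum.elim (fun p => slCorner h g.1.1 p.1 p.2) <|
    Sum.elim (fun p => ((slBlock h g.1.1).submatrix Sum.inl Sum.inl * (slCorner h g.1.1)⁻¹ :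
      Matrix (Fin i) (Fin i) K) p.1 p.2) <|
    Sum.elim (fun p => ((slBlock h g.1.1).submatrix (Sum.inr ∘ Sum.inl) Sum.inl *
      (slCorner h g.1.1)⁻¹ : Matrix (Fin m) (Fin i) K) p.1 p.2) <|
    fun p => ((slCorner h g.1.1)⁻¹ * (slBlock h g.1.1).submatrix (Sum.inr ∘ Sum.inr)
      (Sum.inr ∘ Sum.inl) : Matrix (Fin i) (Fin m) K) p.1 p.2, g.2⟩
  invFun v := ⟨⟨chartSL h (chartCorner v.1) (Matrix.of fun a b => v.1 (Sum.inr (Sum.inl (a, b))))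
    (Matrix.of fun a b => v.1 (Sum.inr (Sum.inr (Sum.inl (a, b)))))
    (Matrix.of fun a b => v.1 (Sum.inr (Sum.inr (Sum.inr (a, b))))),
    chartSL_mem_slX h (isUnit_iff_ne_zero.2 v.2) _ _ _⟩, by
      rw [Set.mem_ofPred_eq, slCorner_chartSL]
      exact v.2⟩
  left_inv g := Subtype.ext <| Subtype.ext <|
    (exists_eq_chartSL h g.1.2 (isUnit_iff_ne_zero.2 g.2)).symm
  right_inv v := by
    have hv := isUnit_iff_ne_zero.2 v.2
    refine Subtype.ext ?_
    simp only [slCorner_chartSL, slBlock_chartSL, chartMatrix_eq_fromCols]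
    ext (⟨a, b⟩ | ⟨a, b⟩ | ⟨a, b⟩ | ⟨a, b⟩)
    · rfl
    · exact congrFun (congrFun (Matrix.mul_nonsing_inv_cancel_right _
        (Matrix.of fun a b => v.1 (Sum.inr (Sum.inl (a, b)))) hv) a) b
    · exact congrFun (congrFun (Matrix.mul_nonsing_inv_cancel_right _
        (Matrix.of fun a b => v.1 (Sum.inr (Sum.inr (Sum.inl (a, b))))) hv) a) b
    · exact congrFun (congrFun (Matrix.nonsing_inv_mul_cancel_left _
        (Matrix.of fun a b => v.1 (Sum.inr (Sum.inr (Sum.inr (a, b))))) hv) a) b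
  continuous_toFun := by
    have hB := (isRegularMatrix_slBlock (K := K) h).comp
      fun g : {g : slX K n i | (slCorner h g.1).det ≠ 0} => g.1.1
    have hA := (isRegularMatrix_slCorner (K := K) h).comp
      fun g : {g : slX K n i | (slCorner h g.1).det ≠ 0} => g.1.1
    have hA' := hA.inv fun g => g.2
    refine Continuous.subtype_mk (continuous_of_regular (continuous_slCoords.comp
      (continuous_subtype_val.comp continuous_subtype_val)) ?_) _
    rintro (p | p | p | p)
    · exact hA p.1 p.2
    · exact ((hB.submatrix Sum.inl Sum.inl).mul hA') p.1 p.2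
    · exact ((hB.submatrix (Sum.inr ∘ Sum.inl) Sum.inl).mul hA') p.1 p.2
    · exact (hA'.mul (hB.submatrix (Sum.inr ∘ Sum.inr) (Sum.inr ∘ Sum.inl))) p.1 p.2
  continuous_invFun := by
    have hA := (isRegularMatrix_chartCorner (K := K)).comp
      fun v : {v : ChartIndex i m → K | (chartCorner v).det ≠ 0} => v.1
    have hYi : IsRegularMatrix (fun v : {v : ChartIndex i m → K | (chartCorner v).det ≠ 0} => v.1)
        fun v => Matrix.of fun a b => v.1 (Sum.inr (Sum.inl (a, b))) :=
      fun a b => coord_mem_regularFunctions _ (Sum.inr (Sum.inl (a, b)))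
    have hYm : IsRegularMatrix (fun v : {v : ChartIndex i m → K | (chartCorner v).det ≠ 0} => v.1)
        fun v => Matrix.of fun a b => v.1 (Sum.inr (Sum.inr (Sum.inl (a, b)))) :=
      fun a b => coord_mem_regularFunctions _ (Sum.inr (Sum.inr (Sum.inl (a, b))))
    have hZm : IsRegularMatrix (fun v : {v : ChartIndex i m → K | (chartCorner v).det ≠ 0} => v.1)
        fun v => Matrix.of fun a b => v.1 (Sum.inr (Sum.inr (Sum.inr (a, b)))) :=
      fun a b => coord_mem_regularFunctions _ (Sum.inr (Sum.inr (Sum.inr (a, b))))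
    refine Continuous.subtype_mk (Continuous.subtype_mk (continuous_sl_of_regular
      (e := fun v : {v : ChartIndex i m → K | (chartCorner v).det ≠ 0} => v.1)
      continuous_subtype_val ?_) _) _
    exact IsRegularMatrix.submatrix ((IsRegularMatrix.const 1).add
      (((hYi.fromRows (hYm.fromRows (IsRegularMatrix.const 1))).mul hA).mul
        ((IsRegularMatrix.const 1).fromCols (hZm.fromCols (hYi.add (hZm.mul hYm)).neg)))) _ _

theorem topologicalKrullDim_slX [IsAlgClosed K] (h : i + (m + i) = n + 1) :
    topologicalKrullDim (slX K n i) = ((i * i + (i * i + (m * i + i * m)) : ℕ) : WithBot ℕ∞) := by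
  have hU : IsOpen {g : slX K n i | (slCorner h g.1).det ≠ 0} :=
    (isOpen_ne_zero_of_regular continuous_slCoords (isRegularMatrix_slCorner h).det).preimage
      continuous_subtype_val
  have hone : chartCorner (i := i) (m := m) (Sum.elim
      (fun p => (1 : Matrix (Fin i) (Fin i) K) p.1 p.2) 0) = 1 := rfl
  rw [topologicalKrullDim_eq_of_isOpen hU fun x => ?_,
    (chartHomeomorph h).isHomeomorph.topologicalKrullDim_eq,
    topologicalKrullDim_isOpen_affineSpace
      (isOpen_ne_zero_of_regular continuous_id isRegularMatrix_chartCorner.det)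
      ⟨_, by rw [Set.mem_ofPred_eq, hone, Matrix.det_one]; exact one_ne_zero⟩]
  · simp
  · have h1 : chartSL h (1 : Matrix (Fin i) (Fin i) K) 0 0 0 ∈ slX K n i :=
      chartSL_mem_slX h (by simp) _ _ _
    obtain ⟨g, hg⟩ := isConj_iff.1 (isConj_of_mem_slX x.2 h1)
    refine ⟨(slConjHomeomorph g).subtype fun y => ⟨fun hy => conj_mem_slX hy g, fun hy => ?_⟩, ?_⟩
    · have := conj_mem_slX hy g⁻¹
      change g⁻¹ * (g * y * g⁻¹) * g⁻¹⁻¹ ∈ slX K n i at this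
      convert this using 1
      group
    · change (slCorner h (g * x.1 * g⁻¹)).det ≠ 0
      rw [hg, slCorner_chartSL, Matrix.det_one]
      exact one_ne_zero

end Dimension

section WeylElement

variable {K : Type*} [Field K] {n i m : ℕ}

theorem val_aIdx {j : ℕ} (hj : 2 * j < n) : (aIdx n j : ℕ) = j :=
  Nat.mod_eq_of_lt (by omega)

theorem val_bIdx (j : ℕ) : (bIdx n j : ℕ) = n - j :=
  Nat.mod_eq_of_lt (by omega)

theorem wPerm_succ (n i : ℕ) :
    wPerm n (i + 1) = wPerm n i * Equiv.swap (aIdx n i) (bIdx n i) := by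
  rw [wPerm, List.ofFn_succ', List.concat_eq_append, List.prod_append]
  simp [wPerm]

theorem nMatProd_succ (n i : ℕ) : nMatProd K n (i + 1) = nMatProd K n i * nMat K n i := by
  rw [nMatProd, List.ofFn_succ', List.concat_eq_append, List.prod_append]
  simp [nMatProd]

theorem val_wPerm (hi : 2 * i ≤ n + 1) (a : Fin (n + 1)) :
    (wPerm n i a : ℕ) = if (a : ℕ) < i ∨ n + 1 - i ≤ a then n - a else a := by
  induction i generalizing a with
  | zero =>
    have := a.isLt
    simp [wPerm]
    omega
  | succ i ih =>
    have ha : (aIdx n i : ℕ) = i := val_aIdx (by omega)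
    have hb := val_bIdx (n := n) i
    have hlt := a.isLt
    rw [wPerm_succ, Equiv.Perm.mul_apply, ih (by omega)]
    rcases eq_or_ne a (aIdx n i) with rfl | h1
    · rw [Equiv.swap_apply_left, ha, hb]
      split_ifs <;> omega
    rcases eq_or_ne a (bIdx n i) with rfl | h2
    · rw [Equiv.swap_apply_right, ha, hb]
      split_ifs <;> omega
    rw [Equiv.swap_apply_of_ne_of_ne h1 h2]
    rw [Ne, Fin.ext_iff, ha] at h1
    rw [Ne, Fin.ext_iff, hb] at h2
    split_ifs <;> omega

theorem wPerm_mul_self (hi : 2 * i ≤ n + 1) : wPerm n i * wPerm n i = 1 := by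
  ext a
  have := a.isLt
  rw [Equiv.Perm.mul_apply, val_wPerm hi, val_wPerm hi, Equiv.Perm.one_apply]
  split_ifs <;> omega

theorem permMat_mul (R : Type*) [CommRing R] {N : ℕ} (σ τ : Equiv.Perm (Fin N)) :
    permMat R (σ * τ) = permMat R σ * permMat R τ := by
  ext a b
  simp only [permMat, Matrix.mul_apply, Matrix.of_apply, mul_ite, mul_one, mul_zero]
  rw [Finset.sum_ite_eq_of_mem _ _ _ (Finset.mem_univ _), Equiv.Perm.mul_apply]

theorem permMat_one (R : Type*) [CommRing R] {N : ℕ} :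
    permMat R (1 : Equiv.Perm (Fin N)) = 1 := by
  ext a b
  simp [permMat, Matrix.one_apply, eq_comm]

theorem transvection_mul_transvection_mul_transvection [CharP K 2] {N : ℕ} {a b : Fin N}
    (hab : a ≠ b) :
    Matrix.transvection a b (1 : K) * Matrix.transvection b a (-1) * Matrix.transvection a b 1 =
      permMat K (Equiv.swap a b) := by
  have h2 : (1 : K) + 1 = 0 := CharTwo.add_self_eq_zero 1
  have h : Matrix.transvection a b (1 : K) * Matrix.transvection b a (-1) *
      Matrix.transvection a b 1 = 1 + Matrix.single a a 1 + Matrix.single b b 1 +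
        Matrix.single a b 1 + Matrix.single b a 1 := by
    have h3 : (Matrix.single a b (1 : K)) + Matrix.single a b 1 = 0 := by
      rw [← Matrix.single_add, h2, Matrix.single_zero]
    simp only [Matrix.transvection, CharTwo.neg_eq, mul_add, add_mul, mul_one, one_mul,
      Matrix.single_mul_single_same, Matrix.single_mul_single_of_ne _ _ _ _ hab.symm]
    rw [← sub_eq_zero]
    refine Eq.trans ?_ h3
    abel
  rw [h]
  ext c d
  simp only [permMat, Matrix.add_apply, Matrix.one_apply, Matrix.single_apply, Matrix.of_apply,
    Equiv.swap_apply_def]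
  clear h
  grind

theorem nMatProd_eq_permMat [CharP K 2] (hi : 2 * i ≤ n + 1) :
    nMatProd K n i = permMat K (wPerm n i) := by
  induction i with
  | zero => simp [nMatProd, wPerm, permMat_one]
  | succ i ih =>
    rw [nMatProd_succ, wPerm_succ, permMat_mul, ih (by omega), nMat,
      transvection_mul_transvection_mul_transvection]
    intro h
    have := congrArg Fin.val h
    rw [val_aIdx (by omega), val_bIdx] at this
    omega

theorem wPerm_blockEquiv (h : i + (m + i) = n + 1) (x : Fin i ⊕ Fin m ⊕ Fin i) :
    wPerm n i (blockEquiv h x) = blockEquiv h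
      (Sum.elim (fun a => Sum.inr (Sum.inr a.rev))
        (Sum.elim (fun b => Sum.inr (Sum.inl b)) fun c => Sum.inl c.rev) x) := by
  apply Fin.ext
  rw [val_wPerm (by omega)]
  rcases x with x | x | x <;> have := x.isLt <;>
    simp only [blockEquiv, Equiv.trans_apply, Equiv.sumCongr_apply, Sum.map_inl, Sum.map_inr,
      Equiv.refl_apply, finSumFinEquiv_apply_left, finSumFinEquiv_apply_right, finCongr_apply,
      Fin.val_cast, Fin.val_castAdd, Fin.val_natAdd, Sum.elim_inl, Sum.elim_inr, Fin.val_rev] <;>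
    split_ifs <;> omega

theorem rank_one_sub_permMat_wPerm (F : Type*) [Field F] (h : i + (m + i) = n + 1) :
    (1 - permMat F (wPerm n i)).rank = i := by
  let J := (1 : Matrix (Fin i) (Fin i) F).submatrix Fin.rev id
  have hJ : J * J = 1 := by
    ext a b
    simp only [J, Matrix.mul_apply, Matrix.submatrix_apply, Matrix.one_apply, id, ite_mul, one_mul,
      zero_mul, Finset.sum_ite_eq, Finset.mem_univ, if_true, Fin.rev_rev]
  have hP : (1 - permMat F (wPerm n i)).submatrix (blockEquiv h) (blockEquiv h) =
      Matrix.fromRows (1 : Matrix (Fin i) (Fin i) F) (Matrix.fromRows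
        (0 : Matrix (Fin m) (Fin i) F) (-J)) *
      Matrix.fromCols (1 : Matrix (Fin i) (Fin i) F) (Matrix.fromCols
        (0 : Matrix (Fin i) (Fin m) F) (-J)) := by
    have hrev : ∀ a b : Fin i, b.rev = a ↔ a.rev = b := fun a b => by
      constructor <;> rintro rfl <;> exact Fin.rev_rev _
    rw [Matrix.fromRows_mul, Matrix.fromRows_mul]
    simp only [Matrix.mul_fromCols]
    ext x y
    rcases x with x | x | x <;> rcases y with y | y | y <;>
      simp [permMat, wPerm_blockEquiv, hJ, J, Matrix.one_apply, hrev]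
    exact sub_eq_zero.2 (if_congr eq_comm rfl rfl)
  apply le_antisymm
  · rw [← Matrix.rank_submatrix (1 - permMat F (wPerm n i)) (blockEquiv h) (blockEquiv h), hP]
    refine (Matrix.rank_mul_le_left _ _).trans ((Matrix.rank_le_card_width _).trans ?_)
    simp
  · have h1 : ((1 - permMat F (wPerm n i)).submatrix (blockEquiv h) (blockEquiv h)).submatrix
        Sum.inl Sum.inl = (1 : Matrix (Fin i) (Fin i) F) := by
      ext a b
      simp [permMat, wPerm_blockEquiv, Matrix.one_apply]
    have h2 := Matrix.rank_submatrix_le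
      ((1 - permMat F (wPerm n i)).submatrix (blockEquiv h) (blockEquiv h)) Sum.inl Sum.inl
    rwa [h1, Matrix.rank_submatrix, Matrix.rank_one, Fintype.card_fin] at h2

theorem two_mul_card_lt (i : ℕ) :
    2 * (∑ a : Fin i, ∑ b : Fin i, if a < b then 1 else 0) + i = i * i := by
  have h1 : (∑ a : Fin i, ∑ b : Fin i, if a < b then 1 else 0) =
      ∑ a : Fin i, ∑ b : Fin i, if b < a then 1 else 0 := Finset.sum_comm
  have h2 : ∑ a : Fin i, ∑ b : Fin i, ((if a < b then 1 else 0) + (if b < a then 1 else 0) +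
      if a = b then 1 else 0) = i * i := by
    have : ∀ a b : Fin i, ((if a < b then 1 else 0) + (if b < a then 1 else 0) +
      if a = b then 1 else 0) = 1 := by
      intro a b
      rcases lt_trichotomy a b with hab | hab | hab
      · simp [hab, hab.not_gt, hab.ne]
      · simp [hab]
      · simp [hab, hab.not_gt, hab.ne']
    simp [this]
  simp only [Finset.sum_add_distrib, ← h1] at h2
  simp at h2
  simp
  omega

theorem lenPerm_wPerm (h : i + (m + i) = n + 1) :
    lenPerm (wPerm n i) + i = i * i + (i * i + (m * i + i * m)) := by
  rw [lenPerm, Nat.card_eq_fintype_card, Fintype.card_subtype, Finset.card_filter,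
    Fintype.sum_prod_type, ← (blockEquiv h).sum_comp]
  simp_rw [← (blockEquiv h).sum_comp, Fintype.sum_sum_type, wPerm_blockEquiv]
  simp only [Fin.lt_def, blockEquiv, Equiv.trans_apply, Equiv.sumCongr_apply, Sum.map_inl,
    Sum.map_inr, Equiv.refl_apply, finSumFinEquiv_apply_left, finSumFinEquiv_apply_right,
    finCongr_apply, Fin.val_cast, Fin.val_castAdd, Fin.val_natAdd, Sum.elim_inl, Sum.elim_inr, Fin.val_rev]
  have e₁ (x y : Fin i) : ((x : ℕ) < y ∧ i + (m + (i - (y + 1))) < i + (m + (i - (x + 1)))) ↔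
      x < y := by
    rw [Fin.lt_def]; omega
  have e₂ (x : Fin i) (y : Fin m) :
      ((x : ℕ) < i + y ∧ i + y < i + (m + (i - (x + 1)))) ↔ True := by
    have := x.isLt; have := y.isLt; simp only [iff_true]; omega
  have e₃ (x y : Fin i) :
      ((x : ℕ) < i + (m + y) ∧ i - (y + 1) < i + (m + (i - (x + 1)))) ↔ True := by
    have := x.isLt; have := y.isLt; simp only [iff_true]; omega
  have e₄ (x : Fin m) (y : Fin i) :
      (i + (x : ℕ) < y ∧ i + (m + (i - (y + 1))) < i + x) ↔ False := by
    have := y.isLt; simp only [iff_false]; omega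
  have e₅ (x y : Fin m) : (i + (x : ℕ) < i + y ∧ i + y < i + x) ↔ False := by
    simp only [iff_false]; omega
  have e₆ (x : Fin m) (y : Fin i) :
      (i + (x : ℕ) < i + (m + y) ∧ i - (y + 1) < i + x) ↔ True := by
    have := x.isLt; have := y.isLt; simp only [iff_true]; omega
  have e₇ (x y : Fin i) :
      (i + (m + (x : ℕ)) < y ∧ i + (m + (i - (y + 1))) < i - (x + 1)) ↔ False := by
    simp only [iff_false]; omega
  have e₈ (x : Fin i) (y : Fin m) :
      (i + (m + (x : ℕ)) < i + y ∧ i + y < i - (x + 1)) ↔ False := by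
    simp only [iff_false]; omega
  have e₉ (x y : Fin i) :
      (i + (m + (x : ℕ)) < i + (m + y) ∧ i - (y + 1) < i - (x + 1)) ↔ x < y := by
    have := x.isLt; have := y.isLt; rw [Fin.lt_def]; omega
  simp only [e₁, e₂, e₃, e₄, e₅, e₆, e₇, e₈, e₉, if_true, if_false, Finset.sum_add_distrib,
    Finset.sum_const, Finset.card_univ, Fintype.card_fin, smul_eq_mul, mul_one, mul_zero, zero_add]
  have h3 := two_mul_card_lt i
  linarith

end WeylElement

theorem det_eq_one_of_mul_self_eq_one {K : Type*} [Field K] [CharP K 2] {N : ℕ}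
    {M : Matrix (Fin N) (Fin N) K} (h : M * M = 1) : M.det = 1 := by
  have h1 : M.det * M.det = 1 := by rw [← Matrix.det_mul, h, Matrix.det_one]
  rcases mul_self_eq_one_iff.1 h1 with h2 | h2
  · exact h2
  · rw [h2, CharTwo.neg_eq]

theorem sub_one_sq_eq_zero_iff {K : Type*} [Field K] [CharP K 2] {N : ℕ}
    {M : Matrix (Fin N) (Fin N) K} : (M - 1) ^ 2 = 0 ↔ M * M = 1 := by
  have h2 : M + M = 0 := by
    ext a b
    exact CharTwo.add_self_eq_zero _
  have h : (M - 1) ^ 2 = M * M - 1 - (M + M) + (1 + 1) := by noncomm_ring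
  have h3 : (1 : Matrix (Fin N) (Fin N) K) + 1 = 0 := by
    ext a b
    exact CharTwo.add_self_eq_zero _
  rw [h, h2, h3, sub_zero, add_zero, sub_eq_zero]

theorem exists_conjClass_eq_slX {K : Type*} [Field K] [IsAlgClosed K] {n : ℕ}
    {u : Matrix.SpecialLinearGroup (Fin (n + 1)) K} (hu : u ≠ 1) (h : (u.1 - 1) ^ 2 = 0) :
    ∃ i, 1 ≤ i ∧ i ≤ (n + 1) / 2 ∧ conjClass u = slX K n i := by
  have hr := two_mul_rank_le_of_sq_zero h
  refine ⟨(u.1 - 1).rank, Nat.one_le_iff_ne_zero.2 fun h0 => hu ?_, by omega,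
    conjClass_eq_slX ⟨h, rfl⟩⟩
  rw [Matrix.rank, Submodule.finrank_eq_zero, LinearMap.range_eq_bot, ← Matrix.toLin'_apply',
    map_eq_zero_iff _ Matrix.toLin'.injective, sub_eq_zero] at h0
  exact Subtype.ext h0

theorem nMatProd_mul_self {K : Type*} [Field K] [CharP K 2] {n i : ℕ} (hi : 2 * i ≤ n + 1) :
    nMatProd K n i * nMatProd K n i = 1 := by
  rw [nMatProd_eq_permMat hi, ← permMat_mul, wPerm_mul_self hi, permMat_one]

theorem rank_nMatProd_sub_one {K : Type*} [Field K] [CharP K 2] {n i : ℕ} (hi : 2 * i ≤ n + 1) :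
    (nMatProd K n i - 1).rank = i := by
  have h : nMatProd K n i - 1 = 1 - nMatProd K n i := by
    ext a b
    simp only [Matrix.sub_apply, CharTwo.sub_eq_add, add_comm]
  rw [h, nMatProd_eq_permMat hi, rank_one_sub_permMat_wPerm K (m := n + 1 - 2 * i) (by omega)]

/-- Let `k` be an algebraically closed field of characteristic 2 and
let `G = SL(n+1, k)`, `n ≥ 1`.  A non-trivial unipotent conjugacy class `O` of `G` is
spherical iff `O = X_i`, the class with Jordan type `2^i ⊕ 1^{n+1-2i}`, for some
`1 ≤ i ≤ ⌊(n+1)/2⌋`; equivalently, iff `O` consists of involutions.  Moreover each `X_i`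
satisfies condition `(*)`: for `w = s_{β₁} ⋯ s_{β_i}` with `β_j = e_j - e_{n+2-j}`
(pairwise orthogonal positive roots), the element `n_{β₁} ⋯ n_{β_i}` lies in
`X_i ∩ BwB`, and `dim X_i = ℓ(w) + rk(1 - w)`. -/
theorem spherical_unipotent_classes_SL_char_two
    [IsAlgClosed k] (hchar : ringChar k = 2) (hn : 1 ≤ n)
    (u : Matrix.SpecialLinearGroup (Fin (n + 1)) k) (hu : u ≠ 1)
    (hunip : IsNilpotent ((u : Matrix (Fin (n + 1)) (Fin (n + 1)) k) - 1)) :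
    (IsSphericalClass (Matrix.SpecialLinearGroup (Fin (n + 1)) k) (conjClass u) ↔
      ∃ i, 1 ≤ i ∧ i ≤ (n + 1) / 2 ∧ conjClass u = slX k n i) ∧
    (IsSphericalClass (Matrix.SpecialLinearGroup (Fin (n + 1)) k) (conjClass u) ↔
      ∀ v ∈ conjClass u, v ^ 2 = 1) ∧
    (∀ i, 1 ≤ i → i ≤ (n + 1) / 2 →
      (∃ g : Matrix.SpecialLinearGroup (Fin (n + 1)) k,
        (g : Matrix (Fin (n + 1)) (Fin (n + 1)) k) = nMatProd k n i ∧
        g ∈ slX k n i ∧ g ∈ slBruhatCell k n (wPerm n i)) ∧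
      topologicalKrullDim (slX k n i) =
        ((lenPerm (wPerm n i) + rkOneSubPerm (wPerm n i) : ℕ) : WithBot ℕ∞)) := by
  have : CharP k 2 := hchar ▸ ringChar.charP k
  have hsq (v : Matrix.SpecialLinearGroup (Fin (n + 1)) k) : v ^ 2 = 1 ↔ (v.1 - 1) ^ 2 = 0 := by
    rw [sub_one_sq_eq_zero_iff, sq]
    exact ⟨fun h => congrArg Subtype.val h, fun h => Subtype.ext h⟩
  have hsph : IsSphericalClass (Matrix.SpecialLinearGroup (Fin (n + 1)) k) (conjClass u) ↔
      ∃ i, 1 ≤ i ∧ i ≤ (n + 1) / 2 ∧ conjClass u = slX k n i := by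
    refine ⟨fun h => exists_conjClass_eq_slX hu (sq_eq_zero_of_isSphericalClass hunip h), ?_⟩
    rintro ⟨i, -, hi, h⟩
    rw [h]
    exact isSphericalClass_slX (by omega)
  refine ⟨hsph, ?_, fun i _ hi => ⟨?_, ?_⟩⟩
  · rw [hsph]
    constructor
    · rintro ⟨i, -, -, h⟩ v hv
      rw [h] at hv
      exact (hsq v).2 hv.1
    · exact fun h => exists_conjClass_eq_slX hu ((hsq u).1 (h u (IsConj.refl u)))
  · have hi' : 2 * i ≤ n + 1 := by omega
    have hg := nMatProd_mul_self (K := k) hi'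
    refine ⟨⟨nMatProd k n i, det_eq_one_of_mul_self_eq_one hg⟩, rfl,
      ⟨sub_one_sq_eq_zero_iff.2 hg, rank_nMatProd_sub_one hi'⟩, 1, one_mem _, 1, one_mem _, ?_⟩
    simp [nMatProd_eq_permMat hi']
  · have hm : i + (n + 1 - 2 * i + i) = n + 1 := by omega
    rw [topologicalKrullDim_slX hm, rkOneSubPerm, rank_one_sub_permMat_wPerm ℝ hm,
      lenPerm_wPerm hm]
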